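/- Suppose K is closed at infinity, H ∩ int(P_d(K)) ≠ ∅ where H = {f − Σ_i θ_i a_i : θ ∈ ℝ^m, θ_i ≥ 0 for m_1 < i ≤ m}, the problem (M) has a minimizer y* with y* ≠ 0, and θ* ∈ ℝ^m is a maximizer of (P). If the LICQC, SCC and SOSC hold at every global minimizer of the homogenized problem (Q̃): minimize f̂(x̃) − Σ_i θ*_i â_i(x̃) subject to c̃_j(x̃) = 0 (j∈E), ‖x̃‖² − 1 = 0, c̃_j(x̃) ≥ 0 (j∈I), x_0 ≥ 0, then there exists k1 ∈ ℕ such that for every k ≥ k1, every minimizer of the kth homogenized moment relaxation has a flat truncation. -/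

import Mathlib

open MvPolynomial MeasureTheory

noncomputable section

/-- The space of real polynomials in `n` variables. -/
abbrev RPoly (n : ℕ) : Type := MvPolynomial (Fin n) ℝ

/-- The degree `|α|` of a monomial power `α`. -/
def mdeg {n : ℕ} (α : Fin n →₀ ℕ) : ℕ := ∑ i, α i

/-- `p` is a sum of squares of polynomials. -/
def IsSOS {n : ℕ} (p : RPoly n) : Prop :=
  ∃ L : List (RPoly n), p = (L.map (fun q => q ^ 2)).sum

/-- The truncation `QM(g)_k` of the quadratic module generated by `(g j)_{j ∈ S}`. -/
def QModDeg {n : ℕ} {κ : Type} (S : Finset κ) (g : κ → RPoly n) (k : ℕ) :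
    Set (RPoly n) :=
  {p | ∃ σ0 : RPoly n, ∃ σ : κ → RPoly n,
      IsSOS σ0 ∧ σ0.totalDegree ≤ k ∧
      (∀ j ∈ S, IsSOS (σ j) ∧ (σ j).totalDegree + (g j).totalDegree ≤ k) ∧
      p = σ0 + ∑ j ∈ S, g j * σ j}

/-- The truncation `Ideal(h)_k` of the ideal generated by `(h j)_{j ∈ S}`. -/
def IdealDeg {n : ℕ} {ι : Type} (S : Finset ι) (h : ι → RPoly n) (k : ℕ) :
    Set (RPoly n) :=
  {p | ∃ q : ι → RPoly n,
      (∀ j ∈ S, (q j).totalDegree + (h j).totalDegree ≤ k) ∧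
      p = ∑ j ∈ S, h j * q j}

/-- The quadratic module `QM(g)` generated by `(g j)_{j ∈ S}`. -/
def QModFull {n : ℕ} {κ : Type} (S : Finset κ) (g : κ → RPoly n) : Set (RPoly n) :=
  {p | ∃ σ0 : RPoly n, ∃ σ : κ → RPoly n,
      IsSOS σ0 ∧ (∀ j ∈ S, IsSOS (σ j)) ∧ p = σ0 + ∑ j ∈ S, g j * σ j}

/-- The ideal `Ideal(h)` generated by `(h j)_{j ∈ S}`. -/
def IdealFull {n : ℕ} {ι : Type} (S : Finset ι) (h : ι → RPoly n) : Set (RPoly n) :=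
  (Ideal.span (h '' (S : Set ι)) : Ideal (RPoly n))

/-- `Ideal(c_eq) + QM(c_in)` is archimedean. -/
def ArchimedeanQM {n : ℕ} (E I : Finset ℕ) (c : ℕ → RPoly n) : Prop :=
  ∃ R : ℝ, 0 < R ∧ ∃ p1 ∈ IdealFull E c, ∃ p2 ∈ QModFull I c,
    (C R : RPoly n) - ∑ i, (X i : RPoly n) ^ 2 = p1 + p2

/-- The basic closed semialgebraic set `K`. -/
def Kset {n : ℕ} (E I : Finset ℕ) (c : ℕ → RPoly n) : Set (Fin n → ℝ) :=
  {x | (∀ j ∈ E, eval x (c j) = 0) ∧ (∀ j ∈ I, 0 ≤ eval x (c j))}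

/-- The bilinear pairing `⟨p, y⟩ = ∑_α p_α y_α`. -/
def pairing {n : ℕ} (p : RPoly n) (y : (Fin n →₀ ℕ) → ℝ) : ℝ :=
  ∑ α ∈ p.support, p.coeff α * y α

/-- Membership in the moment cone `ℛ_d(K)`: the entries `y_α`, `|α| ≤ d`, are the
moments of a finite Borel measure supported in the closed set `K`. -/
def InMomentCone {n : ℕ} (d : ℕ) (K : Set (Fin n → ℝ)) (y : (Fin n →₀ ℕ) → ℝ) : Prop :=
  ∃ μ : Measure (Fin n → ℝ), IsFiniteMeasure μ ∧ μ Kᶜ = 0 ∧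
    ∀ α : Fin n →₀ ℕ, mdeg α ≤ d →
      Integrable (fun x => ∏ i, x i ^ α i) μ ∧
      y α = ∫ x, (∏ i, x i ^ α i) ∂μ

/-- The cone `P_d(K)` of polynomials of degree at most `d` that are nonnegative on `K`. -/
def PdCone {n : ℕ} (d : ℕ) (K : Set (Fin n → ℝ)) : Set (RPoly n) :=
  {p | p.totalDegree ≤ d ∧ ∀ x ∈ K, 0 ≤ eval x p}

/-- The interior of `P_d(K)` in the coefficient topology of `ℝ[x]_d`. -/
def PdInterior {n : ℕ} (d : ℕ) (K : Set (Fin n → ℝ)) : Set (RPoly n) :=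
  {p | p.totalDegree ≤ d ∧ ∃ ε : ℝ, 0 < ε ∧ ∀ q : RPoly n, q.totalDegree ≤ d →
      (∀ α : Fin n →₀ ℕ, |q.coeff α - p.coeff α| ≤ ε) → ∀ x ∈ K, 0 ≤ eval x q}

instance degLEFintype (n t : ℕ) : Fintype {α : Fin n →₀ ℕ // mdeg α ≤ t} := by
  apply Fintype.ofInjective
    (fun a : {α : Fin n →₀ ℕ // mdeg α ≤ t} =>
      (fun i => (⟨a.1 i, by
        have h1 : a.1 i ≤ mdeg a.1 :=
          Finset.single_le_sum (fun j _ => Nat.zero_le _) (Finset.mem_univ i)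
        exact Nat.lt_succ_of_le (le_trans h1 a.2)⟩ : Fin (t + 1))) :
        {α : Fin n →₀ ℕ // mdeg α ≤ t} → (Fin n → Fin (t + 1)))
  intro a b hab
  apply Subtype.ext
  ext i
  exact congrArg Fin.val (congrFun hab i)

/-- The moment matrix `M_t[w]`, indexed by monomial powers of degree at most `t`. -/
def momentMatrix {n : ℕ} (t : ℕ) (w : (Fin n →₀ ℕ) → ℝ) :
    Matrix {α : Fin n →₀ ℕ // mdeg α ≤ t} {α : Fin n →₀ ℕ // mdeg α ≤ t} ℝ :=
  fun α β => w (α.1 + β.1)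

/-- `w` admits a flat truncation: for some `d0 ≤ t ≤ k`,
`rank M_{t-dK}[w] = rank M_t[w]`. -/
def HasFlatTruncation {n : ℕ} (d0 dK k : ℕ) (w : (Fin n →₀ ℕ) → ℝ) : Prop :=
  ∃ t : ℕ, d0 ≤ t ∧ t ≤ k ∧
    (momentMatrix (t - dK) w).rank = (momentMatrix t w).rank

/-- The gradient of a polynomial at a point. -/
def gradP {n : ℕ} (p : RPoly n) (u : Fin n → ℝ) : Fin n → ℝ :=
  fun i => eval u (pderiv i p)

/-- The Hessian of a polynomial at a point. -/
def hessP {n : ℕ} (p : RPoly n) (u : Fin n → ℝ) : Fin n → Fin n → ℝ :=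
  fun i j => eval u (pderiv i (pderiv j p))

/-- The classical optimality conditions (LICQC, KKT with SCC and SOSC) at the point `u`
for the problem: minimize `F` subject to `ge j = 0` (`j ∈ Es`), `gi j ≥ 0` (`j ∈ Is`). -/
def OptCondsAt {n : ℕ} {ι κ : Type}
    (Es : Finset ι) (ge : ι → RPoly n) (Is : Finset κ) (gi : κ → RPoly n)
    (F : RPoly n) (u : Fin n → ℝ) : Prop :=
  -- LICQC: gradients of active constraints are linearly independent
  LinearIndependent ℝ
    (Sum.elim
      (fun j : {j : ι // j ∈ Es ∧ eval u (ge j) = 0} => gradP (ge j.1) u)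
      (fun j : {j : κ // j ∈ Is ∧ eval u (gi j) = 0} => gradP (gi j.1) u)) ∧
  ∃ (lamE : ι → ℝ) (lamI : κ → ℝ),
    -- KKT stationarity
    (gradP F u =
      (∑ j ∈ Es, lamE j • gradP (ge j) u) + ∑ j ∈ Is, lamI j • gradP (gi j) u) ∧
    (∀ j ∈ Is, 0 ≤ lamI j ∧ lamI j * eval u (gi j) = 0) ∧
    -- SCC
    (∀ j ∈ Is, 0 < lamI j + eval u (gi j)) ∧
    -- SOSC
    (∀ v : Fin n → ℝ, v ≠ 0 →
      (∀ j ∈ Es, (∑ i, v i * gradP (ge j) u i) = 0) →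
      (∀ j ∈ Is, eval u (gi j) = 0 → (∑ i, v i * gradP (gi j) u i) = 0) →
      0 < ∑ i, ∑ i', v i *
        ((hessP F u i i' - ∑ j ∈ Es, lamE j * hessP (ge j) u i i')
          - ∑ j ∈ Is, lamI j * hessP (gi j) u i i') * v i')

/-- The degree-`ℓ` homogenization `x_0^ℓ p(x/x_0)` of `p`; the new variable `x_0`
is the variable of index `0` in `Fin (n+1)`. -/
def homogAux {n : ℕ} (ℓ : ℕ) (p : RPoly n) : RPoly (n + 1) :=
  ∑ α ∈ p.support,
    monomial
      (Finsupp.single (0 : Fin (n + 1)) (ℓ - mdeg α) + Finsupp.mapDomain Fin.succ α)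
      (p.coeff α)

/-- The homogenization `p̃` of `p`. -/
def homogenize {n : ℕ} (p : RPoly n) : RPoly (n + 1) := homogAux p.totalDegree p

/-- The polynomial `‖x̃‖² - 1`. -/
def sphereP (n : ℕ) : RPoly (n + 1) := (∑ i, (X i : RPoly (n + 1)) ^ 2) - 1

/-- The homogenization `K̃` of the set `K`. -/
def Khom {n : ℕ} (E I : Finset ℕ) (c : ℕ → RPoly n) : Set (Fin (n + 1) → ℝ) :=
  {x | (∀ j ∈ E, eval x (homogenize (c j)) = 0) ∧
       (∀ j ∈ I, 0 ≤ eval x (homogenize (c j))) ∧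
       (∑ i, (x i) ^ 2) = 1 ∧ 0 ≤ x 0}

/-- `K` is closed at infinity. -/
def ClosedAtInfinity {n : ℕ} (E I : Finset ℕ) (c : ℕ → RPoly n) : Prop :=
  Khom E I c = closure (Khom E I c ∩ {x | 0 < x 0})

/-- The tuple `c̃_eq`: the homogenizations `c̃_j` together with `‖x̃‖² - 1`
(the latter indexed by `none`). -/
def gEqH {n : ℕ} (c : ℕ → RPoly n) : Option ℕ → RPoly (n + 1) :=
  fun o => o.elim (sphereP n) (fun j => homogenize (c j))

/-- The tuple `c̃_in`: the homogenizations `c̃_j` together with `x_0`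
(the latter indexed by `none`). -/
def gInH {n : ℕ} (c : ℕ → RPoly n) : Option ℕ → RPoly (n + 1) :=
  fun o => o.elim (X 0) (fun j => homogenize (c j))

/-- The index set of a tuple extended by one extra entry (indexed by `none`). -/
def OS (S : Finset ℕ) : Finset (Option ℕ) := insert none (S.image some)

/-- Feasibility of `θ` for the linear conic problem (P). -/
def PFeas {n m : ℕ} (m1 d : ℕ) (f : RPoly n) (a : Fin m → RPoly n)
    (K : Set (Fin n → ℝ)) (θ : Fin m → ℝ) : Prop :=
  (∀ i : Fin m, m1 ≤ (i : ℕ) → 0 ≤ θ i) ∧ (f - ∑ i, C (θ i) * a i) ∈ PdCone d K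

/-- The optimal value `ϑ*` of the linear conic problem (P). -/
def PVal {n m : ℕ} (m1 d : ℕ) (f : RPoly n) (a : Fin m → RPoly n) (b : Fin m → ℝ)
    (K : Set (Fin n → ℝ)) : ℝ :=
  sSup {v : ℝ | ∃ θ : Fin m → ℝ, PFeas m1 d f a K θ ∧ v = ∑ i, b i * θ i}

/-- Feasibility of `y` for the generalized moment problem (M). -/
def MFeas {n m : ℕ} (m1 d : ℕ) (a : Fin m → RPoly n) (b : Fin m → ℝ)
    (K : Set (Fin n → ℝ)) (y : (Fin n →₀ ℕ) → ℝ) : Prop :=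
  InMomentCone d K y ∧
  (∀ i : Fin m, (i : ℕ) < m1 → pairing (a i) y = b i) ∧
  (∀ i : Fin m, m1 ≤ (i : ℕ) → b i ≤ pairing (a i) y)

/-- The optimal value `φ*` of the generalized moment problem (M). -/
def MVal {n m : ℕ} (m1 d : ℕ) (f : RPoly n) (a : Fin m → RPoly n) (b : Fin m → ℝ)
    (K : Set (Fin n → ℝ)) : ℝ :=
  sInf {v : ℝ | ∃ y : (Fin n →₀ ℕ) → ℝ, MFeas m1 d a b K y ∧ v = pairing f y}

/-- The optimal value `ϑ_k` of the `k`th SOS relaxation of (P). -/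
def SOSRelaxVal {n m : ℕ} {ι κ : Type} (m1 : ℕ) (f : RPoly n) (a : Fin m → RPoly n)
    (b : Fin m → ℝ) (Es : Finset ι) (ge : ι → RPoly n) (Is : Finset κ) (gi : κ → RPoly n)
    (k : ℕ) : ℝ :=
  sSup {v : ℝ | ∃ θ : Fin m → ℝ, (∀ i : Fin m, m1 ≤ (i : ℕ) → 0 ≤ θ i) ∧
      (∃ p1 ∈ IdealDeg Es ge (2 * k), ∃ p2 ∈ QModDeg Is gi (2 * k),
        f - ∑ i, C (θ i) * a i = p1 + p2) ∧
      v = ∑ i, b i * θ i}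

/-- The semidefinite constraints of the `k`th moment relaxation:
the localizing vectors of the equality constraints vanish, and the localizing
matrices of the inequality constraints and the moment matrix are positive
semidefinite (stated equivalently via the associated quadratic forms). -/
def MomRelaxPSD {n : ℕ} {ι κ : Type} (Es : Finset ι) (ge : ι → RPoly n)
    (Is : Finset κ) (gi : κ → RPoly n) (k : ℕ) (w : (Fin n →₀ ℕ) → ℝ) : Prop :=
  (∀ j ∈ Es, ∀ p : RPoly n, p.totalDegree + (ge j).totalDegree ≤ 2 * k →
      pairing (ge j * p) w = 0) ∧
  (∀ j ∈ Is, ∀ p : RPoly n, p.totalDegree + ((gi j).totalDegree + 1) / 2 ≤ k →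
      0 ≤ pairing (gi j * p ^ 2) w) ∧
  (∀ p : RPoly n, p.totalDegree ≤ k → 0 ≤ pairing (p ^ 2) w)

/-- Feasibility of `w` for the `k`th moment relaxation of (M). -/
def GMomFeas {n m : ℕ} {ι κ : Type} (m1 : ℕ) (a : Fin m → RPoly n) (b : Fin m → ℝ)
    (Es : Finset ι) (ge : ι → RPoly n) (Is : Finset κ) (gi : κ → RPoly n) (k : ℕ)
    (w : (Fin n →₀ ℕ) → ℝ) : Prop :=
  (∀ i : Fin m, (i : ℕ) < m1 → pairing (a i) w = b i) ∧
  (∀ i : Fin m, m1 ≤ (i : ℕ) → b i ≤ pairing (a i) w) ∧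
  MomRelaxPSD Es ge Is gi k w

/-- The optimal value `φ_k` of the `k`th moment relaxation of (M). -/
def GMomVal {n m : ℕ} {ι κ : Type} (m1 : ℕ) (f : RPoly n) (a : Fin m → RPoly n)
    (b : Fin m → ℝ) (Es : Finset ι) (ge : ι → RPoly n) (Is : Finset κ) (gi : κ → RPoly n)
    (k : ℕ) : ℝ :=
  sInf {v : ℝ | ∃ w : (Fin n →₀ ℕ) → ℝ,
      GMomFeas m1 a b Es ge Is gi k w ∧ v = pairing f w}

/-- The optimal value `f_k^den` of the `k`th order relaxation with denominators. -/
def DenRelaxVal {n : ℕ} (E I : Finset ℕ) (c : ℕ → RPoly n) (f : RPoly n) (d k : ℕ) : ℝ :=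
  sSup {γ : ℝ | ∃ p1 ∈ IdealDeg E c (2 * k + d), ∃ p2 ∈ QModDeg I c (2 * k + d),
      (1 + ∑ i, (X i : RPoly n) ^ 2) ^ k * (f - C γ) = p1 + p2}


/-- The degree bound `d_K = max_j ⌈deg(c_j)/2⌉`. -/
def dKOrig {n : ℕ} (E I : Finset ℕ) (c : ℕ → RPoly n) : ℕ :=
  (E ∪ I).sup fun j => ((c j).totalDegree + 1) / 2

/-- The degree bound `d_0` for the GMP relaxations. -/
def d0GMP {n m : ℕ} (f : RPoly n) (a : Fin m → RPoly n) (E I : Finset ℕ)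
    (c : ℕ → RPoly n) : ℕ :=
  max ((f.totalDegree + 1) / 2)
    (max (dKOrig E I c) (Finset.univ.sup fun i : Fin m => ((a i).totalDegree + 1) / 2))

/-- The degree bound `d̃_K` for the homogenized constraining tuples. -/
def dKHom {n : ℕ} (E I : Finset ℕ) (c : ℕ → RPoly n) : ℕ :=
  max ((OS E).sup fun o => ((gEqH c o).totalDegree + 1) / 2)
      ((OS I).sup fun o => ((gInH c o).totalDegree + 1) / 2)

end

namespace FT

/-- quadratic modules of polynomials -/
structure IsQM {N : ℕ} (M : Set (RPoly N)) : Prop where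
  sq : ∀ p, p ^ 2 ∈ M
  add : ∀ p ∈ M, ∀ q ∈ M, p + q ∈ M
  mul : ∀ p ∈ M, ∀ a, a ^ 2 * p ∈ M

variable {N : ℕ} {M : Set (RPoly N)}

lemma IsQM.zero (h : IsQM M) : (0 : RPoly N) ∈ M := by simpa using h.sq 0

lemma IsQM.smul (h : IsQM M) {p : RPoly N} (hp : p ∈ M) {r : ℝ} (hr : 0 ≤ r) : C r * p ∈ M := by
  have := h.mul p hp (C (Real.sqrt r))
  rwa [← map_pow, Real.sq_sqrt hr] at this

lemma IsQM.const (h : IsQM M) {r : ℝ} (hr : 0 ≤ r) : (C r : RPoly N) ∈ M := by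
  have := h.smul (h.sq 1) hr
  simpa using this

lemma IsQM.sumsq_mul (h : IsQM M) {p t : RPoly N} (hp : p ∈ M) (ht : IsSumSq t) : t * p ∈ M := by
  induction ht with
  | zero => simpa using h.zero
  | sq_add a _ ih =>
    rw [add_mul, ← pow_two]
    exact h.add _ (h.mul _ hp _) _ ih

lemma IsQM.sumsq (h : IsQM M) {t : RPoly N} (ht : IsSumSq t) : t ∈ M := by
  have := h.sumsq_mul (h.sq 1) ht
  simpa using this

/-- the module generated by `M` and `a` -/
def ext (M : Set (RPoly N)) (a : RPoly N) : Set (RPoly N) :=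
  {p | ∃ q ∈ M, ∃ t, IsSumSq t ∧ p = q + t * a}

lemma IsQM.ext (h : IsQM M) (a : RPoly N) : IsQM (ext M a) where
  sq p := ⟨p ^ 2, h.sq p, 0, IsSumSq.zero, by ring⟩
  add := by
    rintro _ ⟨q, hq, t, ht, rfl⟩ _ ⟨q', hq', t', ht', rfl⟩
    exact ⟨q + q', h.add _ hq _ hq', t + t', ht.add ht', by ring⟩
  mul := by
    rintro _ ⟨q, hq, t, ht, rfl⟩ b
    exact ⟨b ^ 2 * q, h.mul _ hq _, b ^ 2 * t, (by rw [pow_two]; exact (IsSumSq.mul_self b).mul ht), by ring⟩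

lemma IsQM.supp_mul (h : IsQM M) {a : RPoly N} (h1 : a ∈ M) (h2 : -a ∈ M) (b : RPoly N) :
    b * a ∈ M := by
  have e : b * a = ((C (1/2 : ℝ)) * (b + 1)) ^ 2 * a + ((C (1/2 : ℝ)) * (b - 1)) ^ 2 * (-a) := by
    have : (C (1/2 : ℝ) : RPoly N) * C (1/2 : ℝ) * 4 = 1 := by
      rw [show (4 : RPoly N) = C (4 : ℝ) from (map_ofNat C 4).symm, ← map_mul, ← map_mul]; norm_num
    linear_combination (-(b * a)) * this
  rw [e]
  exact h.add _ (h.mul _ h1 _) _ (h.mul _ h2 _)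

/-- archimedean -/
def Arch (M : Set (RPoly N)) : Prop := ∀ p, ∃ r : ℝ, C r - p ∈ M

lemma total_of_max (h : IsQM M) (hn : (-1 : RPoly N) ∉ M)
    (hmax : ∀ M', IsQM M' → M ⊆ M' → (-1 : RPoly N) ∉ M' → M' ⊆ M) (a : RPoly N) :
    a ∈ M ∨ -a ∈ M := by
  have sub : ∀ a, M ⊆ FT.ext M a := fun a q hq => ⟨q, hq, 0, IsSumSq.zero, by ring⟩
  have mem : ∀ a, a ∈ FT.ext M a := fun a => ⟨0, h.zero, 1, IsSumSq.one, by ring⟩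
  by_contra hcon
  push Not at hcon
  have h1 : (-1 : RPoly N) ∈ FT.ext M a := by
    by_contra h1
    exact hcon.1 (hmax _ (h.ext a) (sub a) h1 (mem a))
  have h2 : (-1 : RPoly N) ∈ FT.ext M (-a) := by
    by_contra h1
    exact hcon.2 (hmax _ (h.ext _) (sub _) h1 (mem _))
  obtain ⟨s1, hs1, t1, ht1, e1⟩ := h1
  obtain ⟨s2, hs2, t2, ht2, e2⟩ := h2
  have k : -(t1 + t2) ∈ M := by
    have : -(t1 + t2) = t1 * s2 + t2 * s1 := by linear_combination t2 * e1 + t1 * e2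
    rw [this]
    exact h.add _ (h.sumsq_mul hs2 ht1) _ (h.sumsq_mul hs1 ht2)
  have k1 : -t1 ∈ M := by
    have := h.add _ k _ (h.sumsq ht2); simpa using this
  have k2 := h.supp_mul (h.sumsq ht1) k1 a
  apply hn
  rw [e1, mul_comm]
  exact h.add _ hs1 _ k2

/-- infinitesimals with respect to `M` -/
def Inf0 (M : Set (RPoly N)) (a : RPoly N) : Prop :=
  ∀ ε : ℝ, 0 < ε → C ε + a ∈ M ∧ C ε - a ∈ M

lemma Inf0.add (h : IsQM M) {a b : RPoly N} (ha : Inf0 M a) (hb : Inf0 M b) : Inf0 M (a + b) := by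
  intro ε hε
  obtain ⟨a1, a2⟩ := ha (ε/2) (by positivity)
  obtain ⟨b1, b2⟩ := hb (ε/2) (by positivity)
  have e : (C ε : RPoly N) = C (ε/2) + C (ε/2) := by rw [← map_add]; norm_num
  constructor
  · convert h.add _ a1 _ b1 using 1; rw [e]; ring
  · convert h.add _ a2 _ b2 using 1; rw [e]; ring

lemma sub_sq_mem (h : IsQM M) {a : RPoly N} {r : ℝ} (hr : 0 < r) (h1 : C r + a ∈ M)
    (h2 : C r - a ∈ M) : C (r ^ 2) - a ^ 2 ∈ M := by
  have := h.smul (h.add _ (h.mul _ h2 (C r + a)) _ (h.mul _ h1 (C r - a)))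
    (r := 1 / (2 * r)) (by positivity)
  convert this using 1
  have e : (C (1 / (2 * r)) : RPoly N) * (2 * C r) = 1 := by
    rw [show (2 : RPoly N) = C (2 : ℝ) from (map_ofNat C 2).symm, ← map_mul, ← map_mul, ← map_one C]
    congr 1; field_simp
  rw [map_pow]
  linear_combination (-(C r + a) * (C r - a)) * e

lemma Inf0.mul (h : IsQM M) (hA : Arch M) {a : RPoly N} (ha : Inf0 M a) (b : RPoly N) :
    Inf0 M (b * a) := by
  obtain ⟨R, hR⟩ := hA (b ^ 2)
  have key : ∀ ε : ℝ, 0 < ε → ∀ s : RPoly N, s ^ 2 = 1 → C ε + s * (b * a) ∈ M := by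
    intro ε hε s hs
    set R' := |R| + 1
    have hR' : C R' - b ^ 2 ∈ M := by
      convert h.add _ hR _ (h.const (r := R' - R) (by simp only [R']; linarith [le_abs_self R])) using 1
      rw [map_sub]; ring
    have hR'0 : 0 < R' := by positivity
    -- δ b² + a²/δ ± 2ab ; δ = ε / R'
    set δ := ε / R'
    have hδ : 0 < δ := by positivity
    obtain ⟨a1, a2⟩ := ha δ hδ
    have h3 := sub_sq_mem h hδ a1 a2
    -- 
    have h4 := h.smul (h.add _ (h.add _ (h.smul h3 (r := 1/δ) (by positivity)) _
      (h.smul hR' hδ.le)) _ (h.smul (h.sq (C δ * s * b + a)) (r := 1/δ) (by positivity))) (r := 1/2) (by positivity)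
    have h5 := h.add _ h4 _ (h.const (r := ε - (δ + ε)/2) (by
      have : δ ≤ ε := by
        apply div_le_self hε.le; simp only [R']; linarith [abs_nonneg R]
      linarith))
    convert h5 using 1
    have e1 : (C (1/δ) : RPoly N) * C δ = 1 := by rw [← map_mul]; simp [hδ.ne']
    have e2 : (C δ : RPoly N) * C R' = C ε := by rw [← map_mul]; congr 1; simp only [δ]; field_simp
    have e3 : (C (ε - (δ + ε)/2) : RPoly N) = C ε - C (1/2) * (C δ + C ε) := by
      rw [← map_add, ← map_mul, ← map_sub]; congr 1; ring
    have e4 : (C (1/2 : ℝ) : RPoly N) * 2 = 1 := by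
      rw [show (2 : RPoly N) = C (2 : ℝ) from (map_ofNat C 2).symm, ← map_mul]; norm_num
    rw [e3, map_pow]
    linear_combination (- C (1/2) * (C δ + C δ * s^2 * b^2 + 2 * s * b * a)) * e1 - C (1/2) * e2
      - s * b * a * e4 - C (1/2) * C δ * b^2 * hs
  intro ε hε
  refine ⟨by simpa using key ε hε 1 (by ring), ?_⟩
  have := key ε hε (-1) (by ring)
  convert this using 1
  ring

lemma span_point (x : Fin N → ℝ) (p : RPoly N) :
    p - C (eval x p) ∈ Ideal.span (Set.range fun i => (X i - C (x i) : RPoly N)) := by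
  induction p using MvPolynomial.induction_on with
  | C a => simp
  | add p q hp hq =>
    have := Ideal.add_mem _ hp hq
    convert this using 1; simp; ring
  | mul_X p i hp =>
    have h1 : (X i - C (x i) : RPoly N) ∈ Ideal.span (Set.range fun i => (X i - C (x i) : RPoly N)) :=
      Ideal.subset_span ⟨i, rfl⟩
    have := Ideal.add_mem _ (Ideal.mul_mem_right (X i) _ hp) (Ideal.mul_mem_left _ (C (eval x p)) h1)
    convert this using 1; simp; ring

lemma exists_point (h : IsQM M) (hA : Arch M) (hn : (-1 : RPoly N) ∉ M) :
    ∃ x : Fin N → ℝ, ∀ p ∈ M, 0 ≤ eval x p := by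
  obtain ⟨M', hMM', hmax⟩ := zorn_subset_nonempty {M' : Set (RPoly N) | IsQM M' ∧ (-1 : RPoly N) ∉ M'}
    (by
      intro c hc hch hne
      refine ⟨⋃₀ c, ⟨⟨?_, ?_, ?_⟩, ?_⟩, fun s hs => Set.subset_sUnion_of_mem hs⟩
      · intro p
        obtain ⟨s, hs⟩ := hne
        exact ⟨s, hs, (hc hs).1.sq p⟩
      · rintro p ⟨s, hs, hp⟩ q ⟨t, ht, hq⟩
        rcases hch.total hs ht with hst | hst
        · exact ⟨t, ht, (hc ht).1.add _ (hst hp) _ hq⟩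
        · exact ⟨s, hs, (hc hs).1.add _ hp _ (hst hq)⟩
      · rintro p ⟨s, hs, hp⟩ a
        exact ⟨s, hs, (hc hs).1.mul _ hp _⟩
      · rintro ⟨s, hs, hp⟩
        exact (hc hs).2 hp) M ⟨h, hn⟩
  obtain ⟨hQ, hn'⟩ := hmax.prop
  have htot : ∀ a, a ∈ M' ∨ -a ∈ M' := by
    apply total_of_max hQ hn'
    intro M'' h1 h2 h3
    exact hmax.le_of_ge ⟨h1, h3⟩ h2
  have hA' : Arch M' := fun p => (hA p).imp fun r hr => hMM' hr
  have neg_const : ∀ r : ℝ, (C r : RPoly N) ∈ M' → 0 ≤ r := by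
    intro r hr
    by_contra hr0
    push Not at hr0
    apply hn'
    have := hQ.smul hr (r := -1/r) (div_nonneg_of_nonpos (by norm_num) hr0.le)
    rw [← map_mul, div_mul_cancel₀ _ hr0.ne] at this
    simpa using this
  have hx : ∀ a : RPoly N, ∃ r : ℝ, Inf0 M' (a - C r) := by
    intro a
    obtain ⟨r1, h1⟩ := hA' a
    obtain ⟨r2, h2⟩ := hA' (-a)
    let T : Set ℝ := {r | a - C r ∈ M'}
    have hbdd : BddAbove T := by
      refine ⟨r1, fun r hr => ?_⟩
      have := hQ.add _ h1 _ hr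
      have e : C r1 - a + (a - C r) = C (r1 - r) := by rw [map_sub]; ring
      rw [e] at this
      linarith [neg_const _ this]
    have hne : T.Nonempty := by
      refine ⟨-r2, ?_⟩
      change a - C (-r2) ∈ M'
      convert h2 using 1
      rw [map_neg]; ring
    refine ⟨sSup T, fun ε hε => ⟨?_, ?_⟩⟩
    · obtain ⟨r, hr, hlt⟩ := exists_lt_of_lt_csSup hne (show sSup T - ε < sSup T by linarith)
      have := hQ.add _ hr _ (hQ.const (r := r - (sSup T - ε)) (by linarith))
      convert this using 1
      simp only [map_sub]; ring
    · have hnot : a - C (sSup T + ε) ∉ M' := by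
        intro hmem
        have := le_csSup hbdd (show sSup T + ε ∈ T from hmem)
        linarith
      have := (htot _).resolve_left hnot
      convert this using 1
      simp only [map_add]; ring
  choose x hx using fun i => hx (X i)
  refine ⟨x, ?_⟩
  have hall : ∀ p, Inf0 M' (p - C (eval x p)) := by
    intro p
    refine Submodule.span_induction (p := fun q _ => Inf0 M' q) ?_ ?_ ?_ ?_ (span_point x p)
    · rintro _ ⟨i, rfl⟩; exact hx i
    · intro ε hε; simpa using hQ.const hε.le
    · intro a b _ _ ha hb; exact ha.add hQ hb
    · intro a b _ hb; exact hb.mul hQ hA' a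
  intro p hp
  by_contra hneg
  push Not at hneg
  have := hQ.add _ (hall p (-(eval x p)/2) (by linarith)).2 _ (hMM' hp)
  have e : C (-(eval x p)/2) - (p - C (eval x p)) + p = C (eval x p / 2) := by
    have : (C (-(eval x p)/2) : RPoly N) = C (eval x p / 2) - C (eval x p) := by
      rw [← map_sub]; congr 1; ring
    rw [this]; ring
  rw [e] at this
  linarith [neg_const _ this]

theorem putinar (h : IsQM M) (hA : Arch M) (s : RPoly N)
    (hs : ∀ x : Fin N → ℝ, (∀ p ∈ M, 0 ≤ eval x p) → 0 < eval x s) : s ∈ M := by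
  have h1 : (-1 : RPoly N) ∈ FT.ext M (-s) := by
    by_contra hn
    have sub : M ⊆ FT.ext M (-s) := fun q hq => ⟨q, hq, 0, IsSumSq.zero, by ring⟩
    have mem : -s ∈ FT.ext M (-s) := ⟨0, h.zero, 1, IsSumSq.one, by ring⟩
    obtain ⟨x, hx⟩ := exists_point (h.ext (-s)) (fun p => (hA p).imp fun r hr => sub hr) hn
    have h1 := hs x fun p hp => hx p (sub hp)
    have h2 := hx _ mem
    simp at h2
    linarith
  obtain ⟨q, hq, t, ht, e⟩ := h1
  have hq' : t * s - 1 ∈ M := by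
    convert hq using 1; linear_combination e
  obtain ⟨r1, hr1⟩ := hA t
  obtain ⟨r2, hr2⟩ := hA (t ^ 2 * s + 1)
  obtain ⟨r3, hr3⟩ := hA (-s)
  set k : ℝ := |r1| + |r2| + 1 with hk
  have hk0 : 0 < k := by positivity
  have mono : ∀ {r r' : ℝ} {p : RPoly N}, C r - p ∈ M → r ≤ r' → C r' - p ∈ M := by
    intro r r' p hp hrr
    convert h.add _ hp _ (h.const (r := r' - r) (by linarith)) using 1
    rw [map_sub]; ring
  have m1 : C (2 * k) - t ∈ M := mono hr1 (by
    have := le_abs_self r1; have := abs_nonneg r2; have := abs_nonneg r1; linarith)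
  have m2 : C (2 * k) - (t ^ 2 * s + 1) ∈ M := mono hr2 (by
    have := le_abs_self r2; have := abs_nonneg r2; have := abs_nonneg r1; linarith)
  have step : ∀ r : ℝ, 0 ≤ r → s + C r ∈ M → s + C (r - 1 / k ^ 2) ∈ M := by
    intro r hr hm
    have := h.smul (h.add _ (h.add _ (h.add _ (h.mul _ hm (C k - t)) _ (h.smul hq' (r := 2 * k) (by positivity))) _
      (h.smul (h.sumsq_mul m1 ht) hr)) _ m2) (r := 1 / k ^ 2) (by positivity)
    convert this using 1
    have e1 : (C (1 / k ^ 2) : RPoly N) * (C k) ^ 2 = 1 := by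
      rw [← map_pow, ← map_mul]; simp [hk0.ne']
    simp only [map_sub, map_mul] at *
    have e2 : (C (2 : ℝ) : RPoly N) = 2 := map_ofNat C 2
    rw [e2]
    linear_combination (- (s + C r)) * e1
  by_contra hsn
  have iter : ∀ i : ℕ, ∀ r : ℝ, r ≤ i * (1 / k ^ 2) → s + C r ∈ M → False := by
    intro i
    induction i with
    | zero =>
      intro r hr hm
      apply hsn
      simp at hr
      have := h.add _ hm _ (h.const (r := -r) (by linarith))
      rw [map_neg] at this
      simpa using this
    | succ i ih =>
      intro r hr hm
      by_cases h0 : 0 ≤ r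
      · refine ih _ ?_ (step r h0 hm)
        push_cast at hr; linarith
      · apply hsn
        have := h.add _ hm _ (h.const (r := -r) (by linarith))
        rw [map_neg] at this
        simpa using this
  obtain ⟨i, hi⟩ := exists_nat_ge (r3 / (1 / k ^ 2))
  refine iter i r3 ?_ ?_
  · rwa [div_le_iff₀ (by positivity)] at hi
  · convert hr3 using 1; ring

end FT

namespace FT
variable {N : ℕ}

/-- maximal ideal of a point -/
noncomputable def mI (u : Fin N → ℝ) : Ideal (RPoly N) := RingHom.ker (eval u)

/-- local coordinate -/
noncomputable def yv (u : Fin N → ℝ) (i : Fin N) : RPoly N := X i - C (u i)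

lemma mem_mI {u : Fin N → ℝ} {p : RPoly N} : p ∈ mI u ↔ eval u p = 0 := RingHom.mem_ker

lemma yv_mem (u : Fin N → ℝ) (i : Fin N) : yv u i ∈ mI u := by simp [mem_mI, yv]

lemma eval_yv (u x : Fin N → ℝ) (i : Fin N) : eval x (yv u i) = x i - u i := by simp [yv]

/-- quadratic form in local coordinates -/
noncomputable def qf (u : Fin N → ℝ) (B : Fin N → Fin N → ℝ) : RPoly N :=
  ∑ a, ∑ b, C (B a b) * (yv u a * yv u b)

/-- value of a quadratic form -/
def qv (B : Fin N → Fin N → ℝ) (v : Fin N → ℝ) : ℝ := ∑ a, ∑ b, v a * B a b * v b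

lemma mem_one {u : Fin N → ℝ} {p : RPoly N} (hp : p ∈ mI u) :
    ∃ c : Fin N → RPoly N, p = ∑ a, c a * yv u a := by
  have h := span_point u p
  rw [mem_mI] at hp
  rw [hp, map_zero, sub_zero, Ideal.mem_span_range_iff_exists_fun] at h
  obtain ⟨c, hc⟩ := h
  exact ⟨c, hc.symm⟩

lemma mem_two {u : Fin N → ℝ} {p : RPoly N} (hp : p ∈ mI u ^ 2) :
    ∃ c : Fin N → Fin N → RPoly N, p = ∑ a, ∑ b, c a b * (yv u a * yv u b) := by
  rw [pow_two] at hp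
  refine Submodule.mul_induction_on hp ?_ ?_
  · intro r hr s hs
    obtain ⟨c, rfl⟩ := mem_one hr
    obtain ⟨d, rfl⟩ := mem_one hs
    refine ⟨fun a b => c a * d b, ?_⟩
    rw [Finset.sum_mul_sum]
    refine Finset.sum_congr rfl fun a _ => Finset.sum_congr rfl fun b _ => by ring
  · rintro _ _ ⟨c, rfl⟩ ⟨d, rfl⟩
    refine ⟨fun a b => c a b + d a b, ?_⟩
    simp only [← Finset.sum_add_distrib, add_mul]

lemma mem_three {u : Fin N → ℝ} {p : RPoly N} (hp : p ∈ mI u ^ 3) :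
    ∃ c : Fin N → Fin N → RPoly N, (∀ a b, c a b ∈ mI u) ∧
      p = ∑ a, ∑ b, c a b * (yv u a * yv u b) := by
  rw [show 3 = 1 + 2 from rfl, pow_add, pow_one] at hp
  refine Submodule.mul_induction_on hp ?_ ?_
  · intro r hr s hs
    obtain ⟨d, rfl⟩ := mem_two hs
    refine ⟨fun a b => r * d a b, fun a b => Ideal.mul_mem_right _ _ hr, ?_⟩
    simp only [Finset.mul_sum, mul_assoc]
  · rintro _ _ ⟨c, hc, rfl⟩ ⟨d, hd, rfl⟩
    refine ⟨fun a b => c a b + d a b, fun a b => Ideal.add_mem _ (hc a b) (hd a b), ?_⟩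
    simp only [← Finset.sum_add_distrib, add_mul]

lemma mem_two_quad {u : Fin N → ℝ} {p : RPoly N} (hp : p ∈ mI u ^ 2) :
    ∃ B, p - qf u B ∈ mI u ^ 3 := by
  obtain ⟨c, rfl⟩ := mem_two hp
  refine ⟨fun a b => eval u (c a b), ?_⟩
  rw [qf, ← Finset.sum_sub_distrib]
  refine Ideal.sum_mem _ fun a _ => ?_
  rw [← Finset.sum_sub_distrib]
  refine Ideal.sum_mem _ fun b _ => ?_
  rw [← sub_mul, show 3 = 1 + (1 + 1) from rfl, pow_add, pow_add, pow_one]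
  refine Ideal.mul_mem_mul ?_ (Ideal.mul_mem_mul (yv_mem _ _) (yv_mem _ _))
  simp [mem_mI]

lemma mul3 {u : Fin N → ℝ} {p q : RPoly N} (hp : p ∈ mI u) (hq : q ∈ mI u ^ 2) :
    p * q ∈ mI u ^ 3 := by
  rw [show 3 = 1 + 2 from rfl, pow_add, pow_one]
  exact Ideal.mul_mem_mul hp hq

lemma mul2 {u : Fin N → ℝ} {p q : RPoly N} (hp : p ∈ mI u) (hq : q ∈ mI u) :
    p * q ∈ mI u ^ 2 := by
  rw [pow_two]
  exact Ideal.mul_mem_mul hp hq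

lemma qf_mem (u : Fin N → ℝ) (B : Fin N → Fin N → ℝ) : qf u B ∈ mI u ^ 2 :=
  Ideal.sum_mem _ fun _ _ => Ideal.sum_mem _ fun _ _ => Ideal.mul_mem_left _ _
    (mul2 (yv_mem _ _) (yv_mem _ _))

lemma taylor (u : Fin N → ℝ) (p : RPoly N) :
    p - C (eval u p) - ∑ a, C (gradP p u a) * yv u a - C (1/2 : ℝ) * qf u (hessP p u)
      ∈ mI u ^ 3 := by
  induction p using MvPolynomial.induction_on with
  | C a => simp [gradP, hessP, qf]
  | add p q hp hq =>
    have := Ideal.add_mem _ hp hq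
    convert this using 1
    have e1 : ∑ a, C (gradP (p + q) u a) * yv u a
        = ∑ a, C (gradP p u a) * yv u a + ∑ a, C (gradP q u a) * yv u a := by
      simp [gradP, add_mul, Finset.sum_add_distrib]
    have e2 : qf u (hessP (p + q) u) = qf u (hessP p u) + qf u (hessP q u) := by
      simp [hessP, qf, add_mul, Finset.sum_add_distrib]
    rw [e1, e2]; simp; ring
  | mul_X p i hp =>
    have h2 : C (1/2 : ℝ) * (yv u i * qf u (hessP p u)) ∈ mI u ^ 3 :=
      Ideal.mul_mem_left _ _ (mul3 (yv_mem _ _) (qf_mem _ _))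
    have := Ideal.add_mem _ (Ideal.mul_mem_left _ (X i) hp) h2
    convert this using 1
    have e1 : ∑ a, C (gradP (p * X i) u a) * yv u a
        = C (u i) * (∑ a, C (gradP p u a) * yv u a) + C (eval u p) * yv u i := by
      simp only [gradP, Derivation.leibniz, smul_eq_mul, map_add, map_mul, eval_X, add_mul,
        Finset.sum_add_distrib, pderiv_X, Finset.mul_sum]
      rw [add_comm]
      congr 1
      · exact Finset.sum_congr rfl fun a _ => by ring
      · rw [Finset.sum_eq_single i]
        · simp
        · intro b _ hb; simp [Pi.single_apply, hb]
        · simp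
    have e2 : qf u (hessP (p * X i) u) = C (u i) * qf u (hessP p u)
        + 2 * (yv u i * ∑ a, C (gradP p u a) * yv u a) := by
      have : ∀ a b : Fin N, hessP (p * X i) u a b = u i * hessP p u a b
          + (if b = i then gradP p u a else 0) + (if a = i then gradP p u b else 0) := by
        intro a b
        simp only [hessP, gradP, Derivation.leibniz, smul_eq_mul, map_add, map_mul, eval_X,
          pderiv_X, Pi.single_apply]
        by_cases h1 : a = i <;> by_cases h2 : b = i
        · subst h1; subst h2; simp; ring
        · subst h1; simp [h2, Ne.symm h2]
        · subst h2; simp [h1, Ne.symm h1]; ring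
        · simp [h1, h2, Ne.symm h1, Ne.symm h2]
      simp only [qf, this, map_add, map_mul, add_mul, Finset.sum_add_distrib, Finset.mul_sum]
      have f1 : ∑ a, ∑ b, C (if b = i then gradP p u a else 0) * (yv u a * yv u b)
          = ∑ a, yv u i * (C (gradP p u a) * yv u a) := by
        refine Finset.sum_congr rfl fun a _ => ?_
        rw [Finset.sum_eq_single i]
        · simp; ring
        · intro b _ hb; simp [hb]
        · simp
      have f2 : ∑ a, ∑ b, C (if a = i then gradP p u b else 0) * (yv u a * yv u b)
          = ∑ a, yv u i * (C (gradP p u a) * yv u a) := by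
        rw [Finset.sum_comm, ← f1]
        refine Finset.sum_congr rfl fun a _ => Finset.sum_congr rfl fun b _ => by ring
      rw [f1, f2, ← Finset.mul_sum, ← Finset.mul_sum]
      simp only [Finset.mul_sum, mul_assoc]
      simp only [← Finset.mul_sum]
      ring
    have e4 : (C (1/2 : ℝ) : RPoly N) * 2 = 1 := by
      rw [show (2 : RPoly N) = C (2 : ℝ) from (map_ofNat C 2).symm, ← map_mul]; norm_num
    have e5 : (X i : RPoly N) = yv u i + C (u i) := by simp [yv]
    rw [e1, e2, map_mul, eval_X, map_mul]
    linear_combination (yv u i * C (eval u p) + yv u i * C (1/2 : ℝ) * qf u (hessP p u)  + yv u i * ∑ a, C (gradP p u a) * yv u a + (C (eval u p) + C (1/2 : ℝ) * qf u (hessP p u) + ∑ a, C (gradP p u a) * yv u a) * (0)) * 0 + (- (yv u i * ∑ a, C (gradP p u a) * yv u a)) * e4 + ((C (eval u p) + ∑ a, C (gradP p u a) * yv u a + C (1/2 : ℝ) * qf u (hessP p u))) * e5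

/-- quadratic forms: large penalty -/
lemma finsler (q r : Fin N → Fin N → ℝ) (hr : ∀ v, 0 ≤ qv r v)
    (hq : ∀ v, v ≠ 0 → qv r v = 0 → 0 < qv q v) :
    ∃ C0 : ℝ, ∀ K, C0 ≤ K → ∀ v, v ≠ 0 → 0 < qv q v + K * qv r v := by
  have cont : ∀ B : Fin N → Fin N → ℝ, Continuous (qv B) := by
    intro B; unfold qv; fun_prop
  have hom : ∀ (B : Fin N → Fin N → ℝ) (t : ℝ) v, qv B (t • v) = t ^ 2 * qv B v := by
    intro B t v
    simp only [qv, Finset.mul_sum, Pi.smul_apply, smul_eq_mul]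
    exact Finset.sum_congr rfl fun a _ => Finset.sum_congr rfl fun b _ => by ring
  have hS : IsCompact (Metric.sphere (0 : Fin N → ℝ) 1) := isCompact_sphere _ _
  obtain ⟨Mb, hMb⟩ := (hS.bddBelow_image (cont q).continuousOn)
  have hA : IsCompact (Metric.sphere (0 : Fin N → ℝ) 1 ∩ {v | qv q v ≤ 0}) :=
    hS.inter_right (isClosed_le (cont q) continuous_const)
  obtain ⟨μ, hμ, hμA⟩ : ∃ μ : ℝ, 0 < μ ∧ ∀ v ∈ Metric.sphere (0 : Fin N → ℝ) 1 ∩ {v | qv q v ≤ 0}, μ ≤ qv r v := by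
    rcases (Metric.sphere (0 : Fin N → ℝ) 1 ∩ {v | qv q v ≤ 0}).eq_empty_or_nonempty with h | h
    · exact ⟨1, one_pos, by simp [h]⟩
    · obtain ⟨v, hv, hmin⟩ := hA.exists_isMinOn h (cont r).continuousOn
      refine ⟨qv r v, lt_of_le_of_ne (hr v) ?_, fun w hw => hmin hw⟩
      intro h0
      have hv0 : v ≠ 0 := by
        rintro rfl; simpa using hv.1
      have := hq v hv0 h0.symm
      have := hv.2
      simp only [Set.mem_ofPred_eq] at this
      linarith
  refine ⟨(|Mb| + 1) / μ, fun K hK v hv => ?_⟩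
  have hK0 : 0 < K := lt_of_lt_of_le (by positivity) hK
  have hn : 0 < ‖v‖ := norm_pos_iff.mpr hv
  have key : ∀ w ∈ Metric.sphere (0 : Fin N → ℝ) 1, 0 < qv q w + K * qv r w := by
    intro w hw
    by_cases h0 : qv q w ≤ 0
    · have h1 := hμA w ⟨hw, h0⟩
      have h2 : Mb ≤ qv q w := hMb ⟨w, hw, rfl⟩
      have h3 : K * μ ≤ K * qv r w := by gcongr
      have h4 : |Mb| + 1 ≤ K * μ := by rwa [div_le_iff₀ hμ] at hK
      have := neg_abs_le Mb
      linarith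
    · have := mul_nonneg hK0.le (hr w)
      push Not at h0
      linarith
  have := key (‖v‖⁻¹ • v) (by simp [norm_smul, hn.ne'])
  rw [hom, hom] at this
  have h5 : 0 < ‖v‖⁻¹ ^ 2 * (qv q v + K * qv r v) := by linarith
  exact (pos_iff_pos_of_mul_pos h5).mp (by positivity)

lemma pd_perturb (q r : Fin N → Fin N → ℝ) (hq : ∀ v, v ≠ 0 → 0 < qv q v) :
    ∃ ε : ℝ, 0 < ε ∧ ∀ e, 0 < e → e ≤ ε → ∀ v, v ≠ 0 → 0 < qv (fun a b => q a b - e * r a b) v := by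
  obtain ⟨C0, hC0⟩ := finsler (fun a b => - r a b) q
    (fun v => by
      by_cases h : v = 0
      · simp [h, qv]
      · exact (hq v h).le)
    (fun v hv h0 => absurd h0 (hq v hv).ne')
  refine ⟨1 / (|C0| + 1), by positivity, fun e he hle v hv => ?_⟩
  have h1 : C0 ≤ 1 / e := by
    have : |C0| + 1 ≤ 1 / e := by
      rw [le_div_iff₀ he]; rwa [le_div_iff₀ (by positivity), mul_comm] at hle
    linarith [le_abs_self C0]
  have := hC0 _ h1 v hv
  have h2 : qv (fun a b => q a b - e * r a b) v = e * (qv (fun a b => - r a b) v + 1 / e * qv q v) := by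
    rw [mul_add, ← mul_assoc, mul_one_div_cancel he.ne', one_mul]
    simp only [qv, Finset.mul_sum, ← Finset.sum_add_distrib]
    exact Finset.sum_congr rfl fun a _ => Finset.sum_congr rfl fun b _ => by ring
  rw [h2]; positivity

/-- basic linear forms -/
noncomputable def lf (u : Fin N → ℝ) (c : Fin N × Fin N × Bool) : RPoly N :=
  yv u c.1 + (if c.2.2 then 1 else -1) * yv u c.2.1

lemma lf_mem (u : Fin N → ℝ) (c) : lf u c ∈ mI u :=
  Ideal.add_mem _ (yv_mem _ _) (Ideal.mul_mem_left _ _ (yv_mem _ _))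

/-- local positivity at `u` -/
def LocPD (u : Fin N → ℝ) (R : RPoly N) : Prop :=
  ∃ B : Fin N → Fin N → ℝ, R - qf u B ∈ mI u ^ 3 ∧ ∀ v, v ≠ 0 → 0 < qv B v

lemma LocPD.rep {u : Fin N → ℝ} {R : RPoly N} (h : LocPD u R) :
    ∃ (α : Fin N × Fin N × Bool → RPoly N) (l : Fin N → RPoly N),
      (∀ c, 0 < eval u (α c)) ∧ (∀ i, l i ∈ mI u) ∧
      R = ∑ c, α c * lf u c ^ 2 + ∑ i, l i ^ 2 := by
  obtain ⟨B, hB, hpd⟩ := h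
  obtain ⟨ρ, hρ, e⟩ := mem_three hB
  obtain ⟨ε, hε, hpd'⟩ := pd_perturb B (fun a b => if a = b then 4 * (N:ℝ) else 0) hpd
  have hpd'' := hpd' ε hε le_rfl
  let P : Matrix (Fin N) (Fin N) ℝ := fun a b => (B a b + B b a) / 2 - ε * (if a = b then 4 * (N:ℝ) else 0)
  have hP : P.PosSemidef := by
    refine Matrix.PosSemidef.of_dotProduct_mulVec_nonneg ?_ ?_
    · refine Matrix.IsHermitian.ext fun a b => ?_
      simp only [P, star_trivial, eq_comm (a := b) (b := a), add_comm (B b a)]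
    · intro v
      have : star v ⬝ᵥ P.mulVec v = qv (fun a b => B a b - ε * (if a = b then 4 * (N:ℝ) else 0)) v := by
        simp only [dotProduct, Matrix.mulVec, star_trivial, qv, Finset.mul_sum, P]
        have e1 : ∑ a, ∑ b, v a * ((B a b) / 2 * v b) = ∑ a, ∑ b, v a * ((B b a) / 2 * v b) := by
          rw [Finset.sum_comm]
          exact Finset.sum_congr rfl fun a _ => Finset.sum_congr rfl fun b _ => by ring
        have e2 : ∑ a, ∑ b, v a * (((B a b + B b a) / 2 - ε * (if a = b then 4 * (N:ℝ) else 0)) * v b)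
          = ∑ a, ∑ b, v a * ((B a b) / 2 * v b) + ∑ a, ∑ b, v a * ((B b a) / 2 * v b) - ∑ a, ∑ b, v a * (ε * (if a = b then 4 * (N:ℝ) else 0)) * v b := by
          simp only [← Finset.sum_add_distrib, ← Finset.sum_sub_distrib]
          exact Finset.sum_congr rfl fun a _ => Finset.sum_congr rfl fun b _ => by ring
        rw [e2, ← e1]
        simp only [← Finset.sum_add_distrib, ← Finset.sum_sub_distrib]
        exact Finset.sum_congr rfl fun a _ => Finset.sum_congr rfl fun b _ => by ring
      rw [this]
      by_cases hv : v = 0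
      · simp [hv, qv]
      · exact (hpd'' v hv).le
  obtain ⟨M, hM⟩ : ∃ M : Matrix (Fin N) (Fin N) ℝ, P = M.conjTranspose * M := by
    open scoped MatrixOrder in
    exact CStarAlgebra.nonneg_iff_eq_star_mul_self.mp hP.nonneg
  refine ⟨fun c => C ε + (if c.2.2 then 1 else -1) * (C (1/4 : ℝ) * ρ c.1 c.2.1),
    fun i => ∑ b, C (M i b) * yv u b, ?_, ?_, ?_⟩
  · intro c
    have : eval u (ρ c.1 c.2.1) = 0 := mem_mI.mp (hρ _ _)
    obtain ⟨c1, c2, c3⟩ := c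
    cases c3 <;> simpa [this] using hε
  · intro i
    exact Ideal.sum_mem _ fun b _ => Ideal.mul_mem_left _ _ (yv_mem _ _)
  · have e0 : R = qf u B + ∑ a, ∑ b, ρ a b * (yv u a * yv u b) := by rw [← e]; ring
    have e1 : ∑ i, (∑ b, C (M i b) * yv u b) ^ 2 = ∑ a, ∑ b, C (P a b) * (yv u a * yv u b) := by
      have : ∀ a b, P a b = ∑ i, M i a * M i b := by
        intro a b; rw [hM]; simp [Matrix.mul_apply]
      simp only [this, map_sum, map_mul, pow_two, Finset.sum_mul_sum]
      simp only [Finset.sum_mul]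
      rw [Finset.sum_comm]
      refine Finset.sum_congr rfl fun a _ => ?_
      rw [Finset.sum_comm]
      exact Finset.sum_congr rfl fun a _ => Finset.sum_congr rfl fun b _ => by ring
    have e2 : ∑ a, ∑ b, C (P a b) * (yv u a * yv u b) = qf u B - C (ε * (4 * N)) * ∑ a, yv u a ^ 2 := by
      have f1 : ∑ a, ∑ b, C (B a b / 2) * (yv u a * yv u b) = ∑ a, ∑ b, C (B b a / 2) * (yv u a * yv u b) := by
        rw [Finset.sum_comm]
        exact Finset.sum_congr rfl fun a _ => Finset.sum_congr rfl fun b _ => by ring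
      have f2 : qf u B = ∑ a, ∑ b, C (B a b / 2) * (yv u a * yv u b) + ∑ a, ∑ b, C (B b a / 2) * (yv u a * yv u b) := by
        rw [← f1]
        simp only [← Finset.sum_add_distrib, qf, ← add_mul, ← map_add, add_halves]
      have f3 : C (ε * (4 * N)) * ∑ a, yv u a ^ 2 = ∑ a, ∑ b, C (ε * (if a = b then 4 * (N:ℝ) else 0)) * (yv u a * yv u b) := by
        rw [Finset.mul_sum]
        refine Finset.sum_congr rfl fun a _ => ?_
        rw [Finset.sum_eq_single a]
        · simp [pow_two]
        · intro b _ hb; simp [Ne.symm hb]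
        · simp
      rw [f2, f3]
      simp only [← Finset.sum_add_distrib, ← Finset.sum_sub_distrib, P]
      refine Finset.sum_congr rfl fun a _ => Finset.sum_congr rfl fun b _ => ?_
      rw [map_sub, add_div, map_add]; ring
    rw [e0, e1, e2, Fintype.sum_prod_type]
    simp only [Fintype.sum_prod_type, Fintype.sum_bool, lf]
    have e4 : (C (1/4 : ℝ) : RPoly N) * 4 = 1 := by
      rw [show (4 : RPoly N) = C (4 : ℝ) from (map_ofNat C 4).symm, ← map_mul]; norm_num
    have e3 : ∀ a b : Fin N, (C ε + 1 * (C (1/4 : ℝ) * ρ a b)) * (yv u a + 1 * yv u b) ^ 2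
        + (C ε + -1 * (C (1/4 : ℝ) * ρ a b)) * (yv u a + -1 * yv u b) ^ 2
        = C ε * 2 * yv u a ^ 2 + C ε * 2 * yv u b ^ 2 + ρ a b * (yv u a * yv u b) := by
      intro a b
      linear_combination (ρ a b * (yv u a * yv u b)) * e4
    simp only [if_true, if_false, Bool.false_eq_true, e3, Finset.sum_add_distrib, Finset.sum_const, Finset.card_univ, Fintype.card_fin, nsmul_eq_mul, ← Finset.mul_sum, map_mul, map_ofNat, map_natCast]
    ring

lemma LocPD.near {u : Fin N → ℝ} {R : RPoly N} (h : LocPD u R) :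
    ∀ᶠ x in nhds u, x ≠ u → 0 < eval x R := by
  obtain ⟨α, l, hα, hl, e⟩ := h.rep
  have h1 : ∀ᶠ x in nhds u, ∀ c, 0 < eval x (α c) := by
    rw [Filter.eventually_all]
    intro c
    exact (MvPolynomial.continuous_eval (α c)).continuousAt.eventually (lt_mem_nhds (hα c))
  filter_upwards [h1] with x hx hne
  rw [e]
  simp only [map_add, map_sum, map_mul, map_pow]
  obtain ⟨a, ha⟩ : ∃ a, x a ≠ u a := by
    by_contra hcon; push Not at hcon; exact hne (funext hcon)
  have h2 : 0 < ∑ c, eval x (α c) * eval x (lf u c) ^ 2 := by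
    apply Finset.sum_pos' (fun c _ => mul_nonneg (hx c).le (sq_nonneg _))
    refine ⟨(a, a, true), Finset.mem_univ _, mul_pos (hx _) ?_⟩
    have : eval x (lf u (a, a, true)) = 2 * (x a - u a) := by
      simp [lf, eval_yv]; ring
    rw [this]
    have := sub_ne_zero.mpr ha
    positivity
  have h3 : 0 ≤ ∑ i, eval x (l i) ^ 2 := Finset.sum_nonneg fun _ _ => sq_nonneg _
  linarith

lemma qv_sub_smul (B D : Fin N → Fin N → ℝ) (u : Fin N → ℝ) (e : ℝ) :
    qf u (fun a b => B a b - e * D a b) = qf u B - C e * qf u D := by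
  simp only [qf, Finset.mul_sum, ← Finset.sum_sub_distrib, map_sub, map_mul]
  exact Finset.sum_congr rfl fun a _ => Finset.sum_congr rfl fun b _ => by ring

lemma LocPD.perturb {u : Fin N → ℝ} {R Φ : RPoly N} (h : LocPD u R) (hΦ : Φ ∈ mI u ^ 2) :
    ∃ ε : ℝ, 0 < ε ∧ ∀ e, 0 < e → e ≤ ε → LocPD u (R - C e * Φ) := by
  obtain ⟨B, hB, hpd⟩ := h
  obtain ⟨D, hD⟩ := mem_two_quad hΦ
  obtain ⟨ε, hε, H⟩ := pd_perturb B D hpd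
  refine ⟨ε, hε, fun e he hle => ⟨_, ?_, H e he hle⟩⟩
  rw [qv_sub_smul]
  have := Ideal.sub_mem _ hB (Ideal.mul_mem_left _ (C e) hD)
  convert this using 1; ring

end FT

namespace FT
variable {N : ℕ}

lemma cpos {X : Set (Fin N → ℝ)} (hX : IsCompact X) {f : (Fin N → ℝ) → ℝ} (hf : Continuous f)
    (h : ∀ x ∈ X, 0 < f x) : ∃ ρ : ℝ, 0 < ρ ∧ ∀ x ∈ X, ρ ≤ f x := by
  rcases X.eq_empty_or_nonempty with h0 | h0
  · exact ⟨1, one_pos, by simp [h0]⟩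
  · obtain ⟨v, hv, hmin⟩ := hX.exists_isMinOn h0 hf.continuousOn
    exact ⟨f v, h v hv, fun x hx => hmin hx⟩

lemma cbd {X : Set (Fin N → ℝ)} (hX : IsCompact X) {f : (Fin N → ℝ) → ℝ} (hf : Continuous f) :
    ∃ B : ℝ, 0 < B ∧ ∀ x ∈ X, |f x| ≤ B := by
  obtain ⟨B, hB⟩ := hX.exists_bound_of_continuousOn hf.continuousOn
  exact ⟨|B| + 1, by positivity, fun x hx => (hB x hx).trans (by linarith [le_abs_self B])⟩

lemma sq_dist_pos {x u : Fin N → ℝ} (h : x ≠ u) : 0 < ∑ a, (x a - u a) ^ 2 := by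
  obtain ⟨a, ha⟩ : ∃ a, x a ≠ u a := by
    by_contra hcon; push Not at hcon; exact h (funext hcon)
  refine Finset.sum_pos' (fun _ _ => sq_nonneg _) ⟨a, Finset.mem_univ _, ?_⟩
  have := sub_ne_zero.mpr ha
  positivity

/-- squared distance polynomial -/
noncomputable def dsq (u : Fin N → ℝ) : RPoly N := ∑ a, yv u a ^ 2

lemma eval_dsq (u x : Fin N → ℝ) : eval x (dsq u) = ∑ a, (x a - u a) ^ 2 := by
  simp [dsq, eval_yv]

lemma dsq_mem (u : Fin N → ℝ) : dsq u ∈ mI u ^ 2 :=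
  Ideal.sum_mem _ fun a _ => Ideal.pow_mem_pow (yv_mem u a) 2

lemma lagrange (S : Finset (Fin N → ℝ)) (u : Fin N → ℝ) :
    ∃ e : RPoly N, eval u e = 1 ∧ ∀ v ∈ S, v ≠ u → eval v e = 0 := by
  classical
  refine ⟨∏ v ∈ S.erase u, C (eval u (dsq v))⁻¹ * dsq v, ?_, ?_⟩
  · rw [map_prod]
    refine Finset.prod_eq_one fun v hv => ?_
    have := sq_dist_pos (Finset.ne_of_mem_erase hv).symm
    rw [map_mul, eval_C]
    refine inv_mul_cancel₀ ?_
    rw [eval_dsq]; exact this.ne'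
  · intro v hv hne
    rw [map_prod]
    refine Finset.prod_eq_zero (Finset.mem_erase.mpr ⟨hne, hv⟩) ?_
    have : eval v (dsq v) = 0 := by rw [eval_dsq]; simp
    rw [map_mul, this, mul_zero]

lemma bump (S : Finset (Fin N → ℝ)) (u : Fin N → ℝ) :
    ∃ e : RPoly N, e - 1 ∈ mI u ^ 2 ∧ ∀ v ∈ S, v ≠ u → e ∈ mI v ^ 2 := by
  obtain ⟨e, h1, h2⟩ := lagrange S u
  refine ⟨e ^ 2 * (2 - e ^ 2), ?_, fun v hv hne => ?_⟩
  · have : (1 - e ^ 2) ∈ mI u := by rw [mem_mI]; simp [h1]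
    have := Ideal.pow_mem_pow this 2
    rw [← neg_mem_iff]
    convert this using 1; ring
  · exact Ideal.mul_mem_right _ _ (Ideal.pow_mem_pow (mem_mI.mpr (h2 v hv hne)) 2)

lemma interp (S : Finset (Fin N → ℝ)) (c : (Fin N → ℝ) → ℝ) :
    ∃ p : RPoly N, ∀ u ∈ S, p - C (c u) ∈ mI u ^ 2 := by
  classical
  choose e he1 he2 using bump S
  refine ⟨∑ u ∈ S, C (c u) * e u, fun u hu => ?_⟩
  rw [← Finset.add_sum_erase _ _ hu]
  have h1 : C (c u) * (e u - 1) ∈ mI u ^ 2 := Ideal.mul_mem_left _ _ (he1 u)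
  have h2 : ∑ v ∈ S.erase u, C (c v) * e v ∈ mI u ^ 2 :=
    Ideal.sum_mem _ fun v hv => Ideal.mul_mem_left _ _
      (he2 v u hu (Finset.ne_of_mem_erase hv).symm)
  have := Ideal.add_mem _ h1 h2
  convert this using 1; ring

lemma squares_core {ι : Type} [Fintype ι] {X : Set (Fin N → ℝ)} (hX : IsCompact X)
    (S : Set (Fin N → ℝ)) (g α : ι → RPoly N) (R : RPoly N) (hR : R = ∑ c, α c * g c ^ 2)
    (hα : ∀ c, ∀ x ∈ S, 0 < eval x (α c)) (hg : ∀ c, ∀ x ∈ S, eval x (g c) = 0)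
    (hz : ∀ x ∈ X, (∀ c, eval x (g c) = 0) → x ∈ S) (hpos : ∀ x ∈ X, x ∉ S → 0 < eval x R) :
    ∃ s : ι → RPoly N, R = ∑ c, s c * g c ^ 2 ∧ ∀ c, ∀ x ∈ X, 0 < eval x (s c) := by
  have cont := fun p : RPoly N => MvPolynomial.continuous_eval p
  let Φ : RPoly N := ∑ c, g c ^ 2
  have hΦe : ∀ x, eval x Φ = ∑ c, (eval x (g c)) ^ 2 := fun x => by simp [Φ]
  have hΦ0 : ∀ x, 0 ≤ eval x Φ := fun x => by
    rw [hΦe]; exact Finset.sum_nonneg fun _ _ => sq_nonneg _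
  have hRnn : ∀ x ∈ X, 0 ≤ eval x R := by
    intro x hx
    by_cases hS : x ∈ S
    · rw [hR]; simp [hg _ x hS]
    · exact (hpos x hx hS).le
  obtain ⟨B, hB, hBX⟩ := cbd hX (cont Φ)
  let δ : ℝ := 1 / (2 * B)
  have hδ : 0 < δ := by positivity
  have hψ1 : ∀ x ∈ X, δ * eval x Φ ≤ 1 / 2 := by
    intro x hx
    have := (le_abs_self _).trans (hBX x hx)
    simp only [δ]
    rw [div_mul_eq_mul_div, div_le_div_iff₀ (by positivity) (by positivity)]
    linarith
  let η : ℕ → RPoly N := fun M => C δ * ∑ i ∈ Finset.range M, (1 - C δ * Φ) ^ i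
  have hη : ∀ M, η M * Φ = 1 - (1 - C δ * Φ) ^ M := by
    intro M
    have := geom_sum_mul (1 - C δ * Φ) M
    simp only [η]
    linear_combination -this
  have hηδ : ∀ M, 1 ≤ M → ∀ x ∈ X, δ ≤ eval x (η M) := by
    intro M hM x hx
    simp only [η, map_mul, eval_C, map_sum, map_pow, map_sub, map_one]
    have h0 : 0 ≤ 1 - δ * eval x Φ := by linarith [hψ1 x hx]
    have : (1:ℝ) ≤ ∑ i ∈ Finset.range M, (1 - δ * eval x Φ) ^ i := by
      have := Finset.single_le_sum (f := fun i => (1 - δ * eval x Φ) ^ i)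
        (fun i _ => pow_nonneg h0 i) (Finset.mem_range.mpr hM)
      simpa using this
    nlinarith
  have key : ∀ c, ∀ᶠ M : ℕ in Filter.atTop, ∀ x ∈ X,
      0 < eval x (α c * (1 - C δ * Φ) ^ M + η M * R) := by
    intro c
    let Y := X ∩ {x | eval x (α c) ≤ 0}
    have hY : IsCompact Y := hX.inter_right (isClosed_le (cont _) continuous_const)
    have hYS : ∀ x ∈ Y, x ∉ S := fun x hx hS => absurd (hα c x hS) (not_lt.mpr hx.2)
    obtain ⟨ρ, hρ, hρY⟩ := cpos hY (cont R) (fun x hx => hpos x hx.1 (hYS x hx))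
    obtain ⟨ψ, hψ, hψY⟩ := cpos hY (cont Φ) (fun x hx => by
      refine lt_of_le_of_ne (hΦ0 x) fun h0 => hYS x hx (hz x hx.1 ?_)
      rw [hΦe, eq_comm, Finset.sum_eq_zero_iff_of_nonneg (fun _ _ => sq_nonneg _)] at h0
      exact fun c => by simpa using h0 c (Finset.mem_univ _))
    obtain ⟨D, hD, hDX⟩ := cbd hX (cont (α c))
    have hlim : Filter.Tendsto (fun M : ℕ => D * (1 - min (δ * ψ) (1/2)) ^ M) Filter.atTop (nhds (D * 0)) := by
      refine Filter.Tendsto.const_mul _ (tendsto_pow_atTop_nhds_zero_of_lt_one ?_ ?_)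
      · linarith [min_le_right (δ * ψ) (1/2)]
      · have : 0 < min (δ * ψ) (1/2) := by positivity
        linarith
    rw [mul_zero] at hlim
    have hev := hlim.eventually (gt_mem_nhds (show 0 < δ * ρ by positivity))
    filter_upwards [hev, Filter.eventually_ge_atTop 1] with M hM hM1 x hx
    have hη' := hηδ M hM1 x hx
    simp only [map_add, map_mul, map_pow, map_sub, map_one, eval_C]
    have h0 : 0 < 1 - δ * eval x Φ := by linarith [hψ1 x hx]
    by_cases hY' : eval x (α c) ≤ 0
    · have hxY : x ∈ Y := ⟨hx, hY'⟩
      have h1 := hρY x hxY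
      have h2 := hψY x hxY
      have h3 : (1 - δ * eval x Φ) ^ M ≤ (1 - min (δ * ψ) (1/2)) ^ M := by
        refine pow_le_pow_left₀ h0.le ?_ M
        have := min_le_left (δ * ψ) (1/2)
        have : δ * ψ ≤ δ * eval x Φ := by gcongr
        linarith
      have h4 : - D ≤ eval x (α c) := by
        have := hDX x hx; rw [abs_le] at this; exact this.1
      have h5 : 0 < (1 - δ * eval x Φ) ^ M := by positivity
      have h6 : δ * ρ ≤ eval x (η M) * eval x R := mul_le_mul hη' h1 hρ.le (hδ.le.trans hη')
      have h7 : -D * (1 - δ * eval x Φ) ^ M ≤ eval x (α c) * (1 - δ * eval x Φ) ^ M := by gcongr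
      have h8 : D * (1 - δ * eval x Φ) ^ M ≤ D * (1 - min (δ * ψ) (1/2)) ^ M := by gcongr
      linarith
    · push Not at hY'
      have := hRnn x hx
      have : 0 ≤ eval x (η M) := by linarith
      positivity
  obtain ⟨M, hM⟩ := (Filter.eventually_all.mpr key).exists
  refine ⟨fun c => α c * (1 - C δ * Φ) ^ M + η M * R, ?_, hM⟩
  have e1 : ∑ c, (α c * (1 - C δ * Φ) ^ M + η M * R) * g c ^ 2
      = (1 - C δ * Φ) ^ M * ∑ c, α c * g c ^ 2 + R * (η M * Φ) := by
    simp only [Φ, Finset.mul_sum, ← Finset.sum_add_distrib]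
    exact Finset.sum_congr rfl fun c _ => by ring
  rw [e1, ← hR, hη]; ring

lemma LocPD.eval {u : Fin N → ℝ} {R : RPoly N} (h : LocPD u R) : MvPolynomial.eval u R = 0 := by
  obtain ⟨B, hB, _⟩ := h
  have : R ∈ mI u := by
    have h1 := Ideal.pow_le_self (show 3 ≠ 0 by norm_num) hB
    have h2 := Ideal.pow_le_self (show 2 ≠ 0 by norm_num) (qf_mem u B)
    simpa using Ideal.add_mem _ h1 h2
  exact mem_mI.mp this

lemma lf_zero {u x : Fin N → ℝ} (h : ∀ c, eval x (lf u c) = 0) : x = u := by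
  funext a
  have := h (a, a, true)
  simp [lf, eval_yv] at this
  linarith

lemma sum_ite_sub {ι : Type} [Fintype ι] [DecidableEq ι] (s g : ι → RPoly N) (c0 : ι) (k : RPoly N) :
    ∑ c, s c * g c ^ 2 - k * g c0 ^ 2 = ∑ c, g c ^ 2 * (s c - if c = c0 then k else 0) := by
  simp only [mul_sub, mul_ite, mul_zero, Finset.sum_sub_distrib]
  rw [Finset.sum_ite_eq' Finset.univ, if_pos (Finset.mem_univ _), mul_comm k]
  congr 1
  exact Finset.sum_congr rfl fun _ _ => mul_comm _ _

lemma core_fin {ι : Type} [Fintype ι] {X : Set (Fin N → ℝ)} (hX : IsCompact X)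
    (S : Set (Fin N → ℝ)) (g α : ι → RPoly N) (R : RPoly N) (hR : R = ∑ c, α c * g c ^ 2)
    (hα : ∀ c, ∀ x ∈ S, 0 < eval x (α c)) (hg : ∀ c, ∀ x ∈ S, eval x (g c) = 0)
    (hz : ∀ x ∈ X, (∀ c, eval x (g c) = 0) → x ∈ S) (hpos : ∀ x ∈ X, x ∉ S → 0 < eval x R)
    {Q : Set (RPoly N)} (hQ : IsQM Q) (hQX : ∀ p : RPoly N, (∀ x ∈ X, 0 < eval x p) → p ∈ Q)
    (c0 : ι) : ∃ κ : ℝ, 0 < κ ∧ R - C κ * g c0 ^ 2 ∈ Q := by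
  classical
  obtain ⟨s, hs, hspos⟩ := squares_core hX S g α R hR hα hg hz hpos
  obtain ⟨κ, hκ, hκX⟩ := cpos hX (MvPolynomial.continuous_eval (s c0)) (hspos _)
  refine ⟨κ / 2, by positivity, ?_⟩
  have e1 : R - C (κ / 2) * g c0 ^ 2 =
      ∑ c, g c ^ 2 * (s c - if c = c0 then C (κ / 2) else 0) := by
    conv_lhs => rw [hs]
    rw [← sum_ite_sub]
  rw [e1]
  refine Finset.sum_induction _ (· ∈ Q) (fun a b ha hb => hQ.add a ha b hb) hQ.zero fun c _ => ?_
  refine hQ.mul _ (hQX _ fun x hx => ?_) _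
  split_ifs with h
  · have := hκX x hx
    rw [h, map_sub, eval_C]; linarith
  · simpa using hspos c x hx

lemma core_alg {ℓ R Φ Cε a1 a2 a3 b1 b2 p : RPoly N} (h2 : ℓ * (R - Cε * Φ) = a2 + a3)
    (h3 : b1 = Cε * a1 + (2 - ℓ) * a2) (h4 : b2 = (2 - ℓ) * a3)
    (h5 : Φ = a1 + (1 - ℓ) ^ 2 + p ^ 2) :
    R = b1 + (b2 + ((Cε + (R - Cε * Φ)) * (1 - ℓ) ^ 2 + Cε * p ^ 2)) := by
  rw [h3, h4]
  linear_combination (2 - ℓ) * h2 + Cε * h5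

lemma core {X : Set (Fin N → ℝ)} (hX : IsCompact X) (S : Finset (Fin N → ℝ)) (R : RPoly N)
    (hpos : ∀ x ∈ X, x ∉ S → 0 < eval x R) (hloc : ∀ u ∈ S, LocPD u R)
    {Q : Set (RPoly N)} (hQ : IsQM Q) (hQX : ∀ p : RPoly N, (∀ x ∈ X, 0 < eval x p) → p ∈ Q)
    (p : RPoly N) (hp : ∀ u ∈ S, eval u p = 0) :
    ∃ κ : ℝ, 0 < κ ∧ R - C κ * p ^ 2 ∈ Q := by
  classical
  choose e he1 he2 using lagrange S
  have hee : ∀ u ∈ S, ∀ v ∈ S, eval v (e u) = if v = u then 1 else 0 := by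
    intro u hu v hv
    split_ifs with h
    · rw [h, he1]
    · exact he2 u v hv h
  let ℓ : RPoly N := ∑ u : S, e u ^ 4
  have hℓ : ∀ v ∈ S, eval v ℓ = 1 := by
    intro v hv
    simp only [ℓ, map_sum, map_pow]
    rw [Finset.sum_eq_single (⟨v, hv⟩ : S)]
    · simp [he1]
    · rintro ⟨u, hu⟩ _ hne
      rw [hee u hu v hv, if_neg]; · simp
      rintro rfl; exact hne rfl
    · simp
  let Φ : RPoly N := (∑ u : S, ∑ c, (e u * lf u.1 c) ^ 2) + (1 - ℓ) ^ 2 + p ^ 2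
  have hΦ : ∀ v ∈ S, Φ ∈ mI v ^ 2 := by
    intro v hv
    refine Ideal.add_mem _ (Ideal.add_mem _ (Ideal.sum_mem _ fun u _ => Ideal.sum_mem _ fun c _ => ?_) ?_) ?_
    · refine Ideal.pow_mem_pow ?_ 2
      by_cases h : v = u
      · exact Ideal.mul_mem_left _ _ (h ▸ lf_mem _ _)
      · exact Ideal.mul_mem_right _ _ (mem_mI.mpr (he2 _ _ hv h))
    · exact Ideal.pow_mem_pow (mem_mI.mpr (by simp [hℓ v hv])) 2
    · exact Ideal.pow_mem_pow (mem_mI.mpr (hp v hv)) 2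
  choose! ε' hε' hloc' using fun u hu => (hloc u hu).perturb (hΦ u hu)
  obtain ⟨ε, hε, hεle⟩ : ∃ ε : ℝ, 0 < ε ∧ ∀ u ∈ S, ε ≤ ε' u := by
    rcases S.eq_empty_or_nonempty with h | h
    · exact ⟨1, one_pos, by simp [h]⟩
    · obtain ⟨v, hv, hmin⟩ := S.exists_min_image ε' h
      exact ⟨ε' v, hε' v hv, hmin⟩
  have hlocε : ∀ u ∈ S, LocPD u (R - C ε * Φ) := fun u hu => hloc' u hu ε hε (hεle u hu)
  choose! α l hα hl hrep using fun u hu => (hlocε u hu).rep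
  let ι := (S × (Fin N × Fin N × Bool)) ⊕ ((S × Fin N) ⊕ (Unit ⊕ Unit))
  let g : ι → RPoly N := Sum.elim (fun q => e q.1 * lf q.1.1 q.2)
    (Sum.elim (fun q => e q.1 ^ 2 * l q.1 q.2) (Sum.elim (fun _ => 1 - ℓ) (fun _ => p)))
  let A : ι → RPoly N := Sum.elim (fun q => C ε + (2 - ℓ) * (α q.1 q.2 * e q.1 ^ 2))
    (Sum.elim (fun q => 2 - ℓ) (Sum.elim (fun _ => C ε + (R - C ε * Φ)) (fun _ => C ε)))
  have hsum : R = ∑ c, A c * g c ^ 2 := by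
    simp only [ι, A, g, Fintype.sum_sum_type, Sum.elim_inl, Sum.elim_inr,
      Finset.univ_unique, Finset.sum_singleton]
    rw [Fintype.sum_prod_type, Fintype.sum_prod_type]
    have h1 : ∀ u : S, e u ^ 4 * (R - C ε * Φ) = ∑ c, (α u c * e u ^ 2) * (e u * lf u.1 c) ^ 2
        + ∑ i, (e u ^ 2 * l u i) ^ 2 := by
      intro u
      rw [hrep u u.2, mul_add, Finset.mul_sum, Finset.mul_sum]
      exact congrArg₂ _ (Finset.sum_congr rfl fun _ _ => by ring)
        (Finset.sum_congr rfl fun _ _ => by ring)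
    have h2 : ℓ * (R - C ε * Φ) = ∑ u : S, ∑ c, (α u c * e u ^ 2) * (e u * lf u.1 c) ^ 2
        + ∑ u : S, ∑ i, (e u ^ 2 * l u i) ^ 2 := by
      simp only [ℓ, Finset.sum_mul, h1, Finset.sum_add_distrib]
    have h3 : ∑ u : S, ∑ c, (C ε + (2 - ℓ) * (α u c * e u ^ 2)) * (e u * lf u.1 c) ^ 2
        = C ε * ∑ u : S, ∑ c, (e u * lf u.1 c) ^ 2 +
          (2 - ℓ) * ∑ u : S, ∑ c, (α u c * e u ^ 2) * (e u * lf u.1 c) ^ 2 := by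
      simp only [Finset.mul_sum, ← Finset.sum_add_distrib]
      exact Finset.sum_congr rfl fun _ _ => Finset.sum_congr rfl fun _ _ => by ring
    have h4 : ∑ u : S, ∑ i, (2 - ℓ) * (e u ^ 2 * l u i) ^ 2 = (2 - ℓ) * ∑ u : S, ∑ i, (e u ^ 2 * l u i) ^ 2 := by
      simp only [Finset.mul_sum]
    have h5 : Φ = (∑ u : S, ∑ c, (e u * lf u.1 c) ^ 2) + (1 - ℓ) ^ 2 + p ^ 2 := rfl
    exact core_alg h2 h3 h4 h5
  refine core_fin hX (S : Set (Fin N → ℝ)) g A R hsum ?_ ?_ ?_ hpos hQ hQX (Sum.inr (Sum.inr (Sum.inr ())))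
  · rintro (⟨u, c⟩ | ⟨u, i⟩ | ⟨⟩ | ⟨⟩) x hx
    · have hx : x ∈ S := hx
      simp only [A, Sum.elim_inl, map_add, map_mul, eval_C, map_sub, hℓ x hx, map_pow, hee u u.2 x hx, map_ofNat]
      split_ifs with h
      · have := hα u u.2 c
        rw [h]; linarith
      · simpa using hε
    · have hx : x ∈ S := hx
      simp [A, hℓ x hx]
    · have hx : x ∈ S := hx
      have := (hlocε x hx).eval
      simp only [A, Sum.elim_inl, Sum.elim_inr, map_add, eval_C, this]; linarith
    · simp [A, hε]
  · rintro (⟨u, c⟩ | ⟨u, i⟩ | ⟨⟩ | ⟨⟩) x hx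
    · have hx : x ∈ S := hx
      simp only [g, Sum.elim_inl, map_mul, hee u u.2 x hx]
      split_ifs with h
      · rw [h, mem_mI.mp (lf_mem u.1 c), mul_zero]
      · simp
    · have hx : x ∈ S := hx
      simp only [g, Sum.elim_inl, Sum.elim_inr, map_mul, map_pow, hee u u.2 x hx]
      split_ifs with h
      · rw [h, mem_mI.mp (hl u u.2 i), mul_zero]
      · simp
    · have hx : x ∈ S := hx
      simp [g, hℓ x hx]
    · exact hp x hx
  · intro x hx h
    have h1 := h (Sum.inr (Sum.inr (Sum.inl ())))
    simp only [g, Sum.elim_inl, Sum.elim_inr, map_sub, map_one] at h1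
    have h2 : ∃ u : S, eval x (e u) ≠ 0 := by
      by_contra hcon
      push Not at hcon
      simp [ℓ, hcon] at h1
    obtain ⟨u, hu⟩ := h2
    have : x = u := lf_zero fun c => by
      have := h (Sum.inl (u, c))
      simp only [g, Sum.elim_inl, map_mul] at this
      exact (mul_eq_zero.mp this).resolve_left hu
    rw [this]; exact u.2

end FT

namespace FT
variable {N : ℕ}

lemma pairing_eq {p : RPoly N} {y : (Fin N →₀ ℕ) → ℝ} {s : Finset (Fin N →₀ ℕ)} (h : p.support ⊆ s) :
    pairing p y = ∑ α ∈ s, p.coeff α * y α := by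
  refine Finset.sum_subset h fun α _ hα => ?_
  rw [notMem_support_iff.mp hα, zero_mul]

/-- the pairing as a linear map -/
noncomputable def pl (y : (Fin N →₀ ℕ) → ℝ) : RPoly N →ₗ[ℝ] ℝ where
  toFun p := pairing p y
  map_add' p q := by
    classical
    rw [pairing_eq (s := p.support ∪ q.support) support_add,
      pairing_eq (p := p) (s := p.support ∪ q.support) Finset.subset_union_left,
      pairing_eq (p := q) (s := p.support ∪ q.support) Finset.subset_union_right,
      ← Finset.sum_add_distrib]
    exact Finset.sum_congr rfl fun α _ => by rw [coeff_add, add_mul]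
  map_smul' r p := by
    rw [pairing_eq (s := p.support) support_smul, pairing_eq (Finset.Subset.refl p.support), RingHom.id_apply, smul_eq_mul,
      Finset.mul_sum]
    exact Finset.sum_congr rfl fun α _ => by rw [coeff_smul, smul_eq_mul, mul_assoc]

lemma pl_apply (y : (Fin N →₀ ℕ) → ℝ) (p : RPoly N) : pl y p = pairing p y := rfl

lemma pl_C_mul (y : (Fin N →₀ ℕ) → ℝ) (r : ℝ) (p : RPoly N) : pl y (C r * p) = r * pl y p := by
  rw [C_mul', map_smul, smul_eq_mul]

lemma pl_monomial (y : (Fin N →₀ ℕ) → ℝ) (α) (r : ℝ) : pl y (monomial α r) = r * y α := by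
  classical
  rw [pl_apply, pairing_eq (s := {α}) support_monomial_subset]
  simp

lemma pl_congr {p : RPoly N} {y z : (Fin N →₀ ℕ) → ℝ} (h : ∀ α ∈ p.support, y α = z α) :
    pl y p = pl z p :=
  Finset.sum_congr rfl fun α hα => by rw [h α hα]

variable {ι κ : Type}

/-- quadratic module plus ideal -/
inductive InQ (Es : Finset ι) (ge : ι → RPoly N) (Is : Finset κ) (gi : κ → RPoly N) : RPoly N → Prop
  | sq (q) : InQ Es ge Is gi (q ^ 2)
  | ineq (j) (hj : j ∈ Is) (q) : InQ Es ge Is gi (gi j * q ^ 2)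
  | eq (j) (hj : j ∈ Es) (q) : InQ Es ge Is gi (ge j * q)
  | add (p q) (hp : InQ Es ge Is gi p) (hq : InQ Es ge Is gi q) : InQ Es ge Is gi (p + q)

variable {Es : Finset ι} {ge : ι → RPoly N} {Is : Finset κ} {gi : κ → RPoly N}

lemma InQ.isQM : IsQM {p | InQ Es ge Is gi p} where
  sq p := InQ.sq p
  add p hp q hq := InQ.add p q hp hq
  mul p hp a := by
    replace hp : InQ Es ge Is gi p := hp
    show InQ Es ge Is gi _
    induction hp with
    | sq q => rw [← mul_pow]; exact InQ.sq _
    | ineq j hj q =>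
      rw [show a ^ 2 * (gi j * q ^ 2) = gi j * (a * q) ^ 2 by ring]; exact InQ.ineq j hj _
    | eq j hj q =>
      rw [show a ^ 2 * (ge j * q) = ge j * (a ^ 2 * q) by ring]; exact InQ.eq j hj _
    | add p q _ _ h1 h2 => rw [mul_add]; exact InQ.add _ _ h1 h2

lemma InQ.nonneg {p : RPoly N} (h : InQ Es ge Is gi p) :
    ∃ k0, ∀ k, k0 ≤ k → ∀ w, MomRelaxPSD Es ge Is gi k w → 0 ≤ pl w p := by
  induction h with
  | sq q => exact ⟨q.totalDegree, fun k hk w hw => hw.2.2 q hk⟩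
  | ineq j hj q =>
    exact ⟨q.totalDegree + ((gi j).totalDegree + 1) / 2, fun k hk w hw => hw.2.1 j hj q hk⟩
  | eq j hj q =>
    exact ⟨q.totalDegree + (ge j).totalDegree, fun k hk w hw =>
      (hw.1 j hj q (by omega)).ge⟩
  | add p q _ _ h1 h2 =>
    obtain ⟨k1, h1⟩ := h1
    obtain ⟨k2, h2⟩ := h2
    refine ⟨max k1 k2, fun k hk w hw => ?_⟩
    rw [map_add]
    exact add_nonneg (h1 k (le_of_max_le_left hk) w hw) (h2 k (le_of_max_le_right hk) w hw)

lemma arch_of_ball {M : Set (RPoly N)} (h : IsQM M) (hb : 1 - ∑ i, (X i : RPoly N) ^ 2 ∈ M) :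
    Arch M := by
  have key : ∀ p : RPoly N, ∃ r : ℝ, 0 < r ∧ C r - p ∈ M ∧ C r + p ∈ M := by
    have hsq : ∀ a : RPoly N, (∃ r : ℝ, 0 < r ∧ C r - a ∈ M ∧ C r + a ∈ M) →
        ∃ r : ℝ, 0 < r ∧ C r - a ^ 2 ∈ M ∧ C r + a ^ 2 ∈ M := by
      rintro a ⟨r, hr, h1, h2⟩
      exact ⟨r ^ 2, by positivity, sub_sq_mem h hr h2 h1,
        h.add _ (h.const (by positivity)) _ (h.sq a)⟩
    have hadd : ∀ a b : RPoly N, (∃ r : ℝ, 0 < r ∧ C r - a ∈ M ∧ C r + a ∈ M) →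
        (∃ r : ℝ, 0 < r ∧ C r - b ∈ M ∧ C r + b ∈ M) →
        ∃ r : ℝ, 0 < r ∧ C r - (a + b) ∈ M ∧ C r + (a + b) ∈ M := by
      rintro a b ⟨r, hr, h1, h2⟩ ⟨s, hs, h3, h4⟩
      refine ⟨r + s, by positivity, ?_, ?_⟩
      · have := h.add _ h1 _ h3
        convert this using 1; rw [map_add]; ring
      · have := h.add _ h2 _ h4
        convert this using 1; rw [map_add]; ring
    have hneg : ∀ a : RPoly N, (∃ r : ℝ, 0 < r ∧ C r - a ∈ M ∧ C r + a ∈ M) →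
        (∃ r : ℝ, 0 < r ∧ C r - (-a) ∈ M ∧ C r + (-a) ∈ M) := by
      rintro a ⟨r, hr, h1, h2⟩
      exact ⟨r, hr, by rwa [sub_neg_eq_add], by rwa [← sub_eq_add_neg]⟩
    have hsm : ∀ (a : RPoly N), (∃ r : ℝ, 0 < r ∧ C r - a ∈ M ∧ C r + a ∈ M) →
        (∃ r : ℝ, 0 < r ∧ C r - C (1/4 : ℝ) * a ∈ M ∧ C r + C (1/4 : ℝ) * a ∈ M) := by
      rintro a ⟨r, hr, h1, h2⟩
      refine ⟨1/4 * r, by positivity, ?_, ?_⟩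
      · have := h.smul h1 (r := 1/4) (by norm_num)
        convert this using 1; rw [map_mul]; ring
      · have := h.smul h2 (r := 1/4) (by norm_num)
        convert this using 1; rw [map_mul]; ring
    intro p
    induction p using MvPolynomial.induction_on with
    | C a =>
      refine ⟨|a| + 1, by positivity, ?_, ?_⟩
      · rw [← map_sub]; exact h.const (by linarith [le_abs_self a])
      · rw [← map_add]; exact h.const (by linarith [neg_abs_le a])
    | add p q hp hq => exact hadd _ _ hp hq
    | mul_X p i hp =>
      have hX : ∃ r : ℝ, 0 < r ∧ C r - (X i : RPoly N) ∈ M ∧ C r + X i ∈ M := by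
        have h1 : 1 - (X i : RPoly N) ^ 2 ∈ M := by
          have h2 : ∑ j ∈ Finset.univ.erase i, (X j : RPoly N) ^ 2 ∈ M :=
            Finset.sum_induction _ (· ∈ M) (fun a b ha hb => h.add a ha b hb) h.zero fun c _ => h.sq _
          have := h.add _ hb _ h2
          convert this using 1
          rw [← Finset.add_sum_erase _ _ (Finset.mem_univ i)]; ring
        have e4 : (C (1/2 : ℝ) : RPoly N) * 2 = 1 := by
          rw [show (2 : RPoly N) = C (2 : ℝ) from (map_ofNat C 2).symm, ← map_mul]; norm_num
        refine ⟨1, one_pos, ?_, ?_⟩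
        · have := h.smul (h.add _ h1 _ (h.sq (1 - X i))) (r := 1/2) (by norm_num)
          convert this using 1
          rw [map_one]
          linear_combination (-(1 - X i)) * e4
        · have := h.smul (h.add _ h1 _ (h.sq (1 + X i))) (r := 1/2) (by norm_num)
          convert this using 1
          rw [map_one]
          linear_combination (-(1 + X i)) * e4
      have := hsm _ (hadd _ _ (hsq _ (hadd _ _ hp hX)) (hneg _ (hsq _ (hadd _ _ hp (hneg _ hX)))))
      have e4 : (C (1/4 : ℝ) : RPoly N) * 4 = 1 := by
        rw [show (4 : RPoly N) = C (4 : ℝ) from (map_ofNat C 4).symm, ← map_mul]; norm_num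
      have e5 : C (1/4 : ℝ) * ((p + X i) ^ 2 + -(p + -X i) ^ 2) = p * X i := by
        linear_combination (p * X i) * e4
      rwa [e5] at this
  intro p
  obtain ⟨r, _, h1, _⟩ := key p
  exact ⟨r, h1⟩

/-- feasible set -/
def Feas (Es : Finset ι) (ge : ι → RPoly N) (Is : Finset κ) (gi : κ → RPoly N) : Set (Fin N → ℝ) :=
  {x | (∀ j ∈ Es, eval x (ge j) = 0) ∧ ∀ j ∈ Is, 0 ≤ eval x (gi j)}

lemma InQ.of_pos (j0 : ι) (hj0 : j0 ∈ Es) (hge : ge j0 = ∑ i, (X i : RPoly N) ^ 2 - 1)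
    (p : RPoly N) (hp : ∀ x ∈ Feas Es ge Is gi, 0 < eval x p) : p ∈ {p | InQ Es ge Is gi p} := by
  refine putinar InQ.isQM (arch_of_ball InQ.isQM ?_) p fun x hx => hp x ⟨fun j hj => ?_, fun j hj => ?_⟩
  · have := InQ.eq (Es := Es) (ge := ge) (Is := Is) (gi := gi) j0 hj0 (-1)
    rw [hge] at this
    show InQ Es ge Is gi _
    convert this using 1; ring
  · have h1 := hx _ (InQ.eq j hj 1)
    have h2 := hx _ (InQ.eq j hj (-1))
    simp at h1 h2
    linarith
  · have h1 := hx _ (InQ.ineq j hj 1)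
    simpa using h1

lemma Feas.isCompact (j0 : ι) (hj0 : j0 ∈ Es) (hge : ge j0 = ∑ i, (X i : RPoly N) ^ 2 - 1) :
    IsCompact (Feas Es ge Is gi) := by
  have hclosed : IsClosed (Feas Es ge Is gi) := by
    have : Feas Es ge Is gi = (⋂ j ∈ Es, {x | eval x (ge j) = 0}) ∩ ⋂ j ∈ Is, {x | 0 ≤ eval x (gi j)} := by
      ext x; simp [Feas]
    rw [this]
    refine IsClosed.inter (isClosed_biInter fun j _ => ?_) (isClosed_biInter fun j _ => ?_)
    · exact isClosed_eq (MvPolynomial.continuous_eval _) continuous_const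
    · exact isClosed_le continuous_const (MvPolynomial.continuous_eval _)
  refine Metric.isCompact_of_isClosed_isBounded hclosed ?_
  refine (Metric.isBounded_closedBall (x := (0 : Fin N → ℝ)) (r := 1)).subset fun x hx => ?_
  rw [mem_closedBall_zero_iff, pi_norm_le_iff_of_nonneg zero_le_one]
  intro i
  have h1 := hx.1 j0 hj0
  rw [hge] at h1
  simp at h1
  have h2 := Finset.single_le_sum (f := fun i => x i ^ 2) (fun i _ => sq_nonneg _) (Finset.mem_univ i)
  rw [Real.norm_eq_abs, abs_le_one_iff_mul_self_le_one]
  nlinarith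

end FT

namespace FT
variable {N : ℕ} {ι κ : Type}

lemma qf_add (u : Fin N → ℝ) (B D : Fin N → Fin N → ℝ) :
    qf u (fun a b => B a b + D a b) = qf u B + qf u D := by
  simp only [qf, ← Finset.sum_add_distrib, map_add, add_mul]

lemma qf_smul (u : Fin N → ℝ) (r : ℝ) (B : Fin N → Fin N → ℝ) :
    qf u (fun a b => r * B a b) = C r * qf u B := by
  simp only [qf, Finset.mul_sum, map_mul, mul_assoc]

lemma qf_sum {J : Type} (s : Finset J) (u : Fin N → ℝ) (B : J → Fin N → Fin N → ℝ) :
    qf u (fun a b => ∑ j ∈ s, B j a b) = ∑ j ∈ s, qf u (B j) := by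
  simp only [qf, map_sum, Finset.sum_mul]
  rw [Finset.sum_comm (s := s)]
  exact Finset.sum_congr rfl fun a _ => Finset.sum_comm

/-- linear part -/
noncomputable def lin (u : Fin N → ℝ) (x : Fin N → ℝ) : RPoly N := ∑ a, C (x a) * yv u a

lemma lin_mem (u x : Fin N → ℝ) : lin u x ∈ mI u :=
  Ideal.sum_mem _ fun _ _ => Ideal.mul_mem_left _ _ (yv_mem _ _)

lemma qf_outer (u x : Fin N → ℝ) : qf u (fun a b => x a * x b) = lin u x ^ 2 := by
  rw [pow_two, lin, Finset.sum_mul_sum, qf]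
  exact Finset.sum_congr rfl fun a _ => Finset.sum_congr rfl fun b _ => by rw [map_mul]; ring

lemma qv_add (B D : Fin N → Fin N → ℝ) (v : Fin N → ℝ) :
    qv (fun a b => B a b + D a b) v = qv B v + qv D v := by
  simp only [qv, ← Finset.sum_add_distrib, mul_add, add_mul]

lemma qv_smul (r : ℝ) (B : Fin N → Fin N → ℝ) (v : Fin N → ℝ) :
    qv (fun a b => r * B a b) v = r * qv B v := by
  simp only [qv, Finset.mul_sum]
  exact Finset.sum_congr rfl fun a _ => Finset.sum_congr rfl fun b _ => by ring

lemma qv_sum {J : Type} (s : Finset J) (B : J → Fin N → Fin N → ℝ) (v : Fin N → ℝ) :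
    qv (fun a b => ∑ j ∈ s, B j a b) v = ∑ j ∈ s, qv (B j) v := by
  simp only [qv, Finset.mul_sum, Finset.sum_mul]
  rw [Finset.sum_comm (s := s)]
  exact Finset.sum_congr rfl fun a _ => Finset.sum_comm

lemma qv_outer (x v : Fin N → ℝ) : qv (fun a b => x a * x b) v = (∑ a, v a * x a) ^ 2 := by
  rw [pow_two, Finset.sum_mul_sum, qv]
  exact Finset.sum_congr rfl fun a _ => Finset.sum_congr rfl fun b _ => by ring

lemma sq_lin {u : Fin N → ℝ} {g : RPoly N} (h : eval u g = 0) :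
    g ^ 2 - lin u (gradP g u) ^ 2 ∈ mI u ^ 3 := by
  have h1 : g - lin u (gradP g u) ∈ mI u ^ 2 := by
    have h2 := Ideal.pow_le_pow_right (show 2 ≤ 3 by norm_num) (taylor u g)
    have h3 := Ideal.add_mem _ h2 (Ideal.mul_mem_left _ (C (1/2 : ℝ)) (qf_mem u (hessP g u)))
    rw [h] at h3
    convert h3 using 1
    rw [lin, map_zero]; ring
  have h4 : g + lin u (gradP g u) ∈ mI u := Ideal.add_mem _ (mem_mI.mpr h) (lin_mem _ _)
  have := mul3 h4 h1
  convert this using 1; ring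

lemma LocPD.congr {u : Fin N → ℝ} {R R' : RPoly N} (h : LocPD u R) (h' : R' - R ∈ mI u ^ 3) :
    LocPD u R' := by
  obtain ⟨B, hB, hp⟩ := h
  refine ⟨B, ?_, hp⟩
  have := Ideal.add_mem _ h' hB
  convert this using 1; ring

/-- local representation polynomial -/
noncomputable def Rloc (Es : Finset ι) (ge : ι → RPoly N) (Is : Finset κ) (gi : κ → RPoly N)
    (F : RPoly N) (lamE : ι → ℝ) (lamI : κ → ℝ) (K : ℝ) : RPoly N :=
  F - ∑ j ∈ Es, (C (lamE j) - C K * ge j) * ge j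
    - ∑ j ∈ Is, C (lamI j) * (1 - C K * gi j) ^ 2 * gi j

lemma local_pd {Es : Finset ι} {ge : ι → RPoly N} {Is : Finset κ} {gi : κ → RPoly N}
    {F : RPoly N} {u : Fin N → ℝ} (hu : ∀ j ∈ Es, eval u (ge j) = 0) (hF : eval u F = 0)
    {lamE : ι → ℝ} {lamI : κ → ℝ}
    (kkt : gradP F u =
      (∑ j ∈ Es, lamE j • gradP (ge j) u) + ∑ j ∈ Is, lamI j • gradP (gi j) u)
    (hcomp : ∀ j ∈ Is, 0 ≤ lamI j ∧ lamI j * eval u (gi j) = 0)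
    (scc : ∀ j ∈ Is, 0 < lamI j + eval u (gi j))
    (sosc : ∀ v : Fin N → ℝ, v ≠ 0 →
      (∀ j ∈ Es, (∑ i, v i * gradP (ge j) u i) = 0) →
      (∀ j ∈ Is, eval u (gi j) = 0 → (∑ i, v i * gradP (gi j) u i) = 0) →
      0 < ∑ i, ∑ i', v i *
        ((hessP F u i i' - ∑ j ∈ Es, lamE j * hessP (ge j) u i i')
          - ∑ j ∈ Is, lamI j * hessP (gi j) u i i') * v i') :
    ∃ C0 : ℝ, ∀ K, C0 ≤ K → LocPD u (Rloc Es ge Is gi F lamE lamI K) := by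
  let A : RPoly N := F - ∑ j ∈ Es, C (lamE j) * ge j - ∑ j ∈ Is, C (lamI j) * gi j
  let H : Fin N → Fin N → ℝ := fun i i' => ((hessP F u i i' - ∑ j ∈ Es, lamE j * hessP (ge j) u i i')
          - ∑ j ∈ Is, lamI j * hessP (gi j) u i i')
  have hA : A - C (1/2 : ℝ) * qf u H ∈ mI u ^ 3 := by
    have h1 := taylor u A
    have h2 : eval u A = 0 := by
      simp only [A, map_sub, map_sum, map_mul, eval_C, hF]
      rw [Finset.sum_eq_zero fun j hj => by rw [hu j hj, mul_zero],
        Finset.sum_eq_zero fun j hj => (hcomp j hj).2]; simp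
    have h3 : gradP A u = 0 := by
      funext a
      have := congrFun kkt a
      simp only [gradP, A, map_sub, map_sum, pderiv_C_mul, map_mul, eval_C, Pi.add_apply, Finset.sum_apply, Pi.smul_apply, smul_eq_mul, Pi.zero_apply, smul_eval] at this ⊢
      linarith
    have h4 : hessP A u = H := by
      funext a b
      simp only [hessP, A, H, map_sub, map_sum, pderiv_C_mul, map_mul, eval_C, map_smul, smul_eval]
    rw [h2, h3, h4] at h1
    simpa using h1
  let r : Fin N → Fin N → ℝ := fun a b =>
    (∑ j ∈ Is, (2 * lamI j) * (gradP (gi j) u a * gradP (gi j) u b)) +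
      ∑ j ∈ Es, gradP (ge j) u a * gradP (ge j) u b
  have hr : ∀ v, qv r v = (∑ j ∈ Is, (2 * lamI j) * (∑ a, v a * gradP (gi j) u a) ^ 2)
      + ∑ j ∈ Es, (∑ a, v a * gradP (ge j) u a) ^ 2 := by
    intro v
    simp only [r, qv_add, qv_sum, qv_smul, qv_outer]
  have hn1 : ∀ v : Fin N → ℝ, ∀ j ∈ Is, 0 ≤ (2 * lamI j) * (∑ a, v a * gradP (gi j) u a) ^ 2 := by
    intro v j hj
    have := (hcomp j hj).1
    positivity
  have hn2 : ∀ v : Fin N → ℝ, ∀ j ∈ Es, 0 ≤ (∑ a, v a * gradP (ge j) u a) ^ 2 :=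
    fun v j _ => sq_nonneg _
  obtain ⟨C0, hC0⟩ := finsler (fun a b => 1/2 * H a b) r
    (fun v => by
      rw [hr]
      exact add_nonneg (Finset.sum_nonneg (hn1 v)) (Finset.sum_nonneg (hn2 v)))
    (fun v hv h0 => by
      rw [hr] at h0
      obtain ⟨h1, h2⟩ := (add_eq_zero_iff_of_nonneg (Finset.sum_nonneg (hn1 v)) (Finset.sum_nonneg (hn2 v))).mp h0
      rw [Finset.sum_eq_zero_iff_of_nonneg (hn1 v)] at h1
      rw [Finset.sum_eq_zero_iff_of_nonneg (hn2 v)] at h2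
      rw [qv_smul]
      have := sosc v hv (fun j hj => by simpa using h2 j hj) (fun j hj hg => by
        have h3 := scc j hj
        rw [hg, add_zero] at h3
        have h4 := h1 j hj
        simpa [h3.ne'] using h4)
      have : 0 < qv H v := this
      positivity)
  refine ⟨C0, fun K hK => ⟨fun a b => 1/2 * H a b + K * r a b, ?_, fun v hv => ?_⟩⟩
  · have e1 : qf u (fun a b => 1/2 * H a b + K * r a b) = C (1/2 : ℝ) * qf u H +
        C K * (∑ j ∈ Is, C (2 * lamI j) * lin u (gradP (gi j) u) ^ 2
          + ∑ j ∈ Es, lin u (gradP (ge j) u) ^ 2) := by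
      simp only [r, qf_add, qf_sum, qf_smul, qf_outer]
    have h1 : ∀ j ∈ Es, C K * (ge j ^ 2 - lin u (gradP (ge j) u) ^ 2) ∈ mI u ^ 3 :=
      fun j hj => Ideal.mul_mem_left _ _ (sq_lin (hu j hj))
    have h2 : ∀ j ∈ Is, C (lamI j) * gi j - C (lamI j) * (1 - C K * gi j) ^ 2 * gi j
        - C K * (C (2 * lamI j) * lin u (gradP (gi j) u) ^ 2) ∈ mI u ^ 3 := by
      intro j hj
      by_cases hl : lamI j = 0
      · simp [hl]
      · have hg : eval u (gi j) = 0 := (mul_eq_zero.mp (hcomp j hj).2).resolve_left hl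
        have t1 := Ideal.mul_mem_left _ (C K * C (2 * lamI j)) (sq_lin hg)
        have t2 := Ideal.mul_mem_left _ (- C (lamI j) * C K ^ 2) (Ideal.pow_mem_pow (mem_mI.mpr hg) 3)
        have := Ideal.add_mem _ t1 t2
        convert this using 1
        rw [map_mul, map_ofNat C 2]; ring
    have := Ideal.add_mem _ (Ideal.add_mem _ hA (Ideal.sum_mem _ h1)) (Ideal.sum_mem _ h2)
    convert this using 1
    rw [e1]
    simp only [Rloc, A, sub_mul, mul_sub, Finset.sum_sub_distrib, ← Finset.mul_sum]
    rw [show ∑ j ∈ Es, C K * ge j * ge j = C K * ∑ j ∈ Es, ge j ^ 2 by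
      rw [Finset.mul_sum]; exact Finset.sum_congr rfl fun _ _ => by ring]
    ring
  · rw [qv_add, qv_smul K]
    exact hC0 K hK v hv

end FT

namespace FT
variable {N : ℕ} {ι κ : Type}

lemma eval_Rloc_le {Es : Finset ι} {ge : ι → RPoly N} {Is : Finset κ} {gi : κ → RPoly N}
    {F : RPoly N} {lamE : ι → ℝ} {lamI : κ → ℝ} {K : ℝ} {x : Fin N → ℝ}
    (hx : x ∈ Feas Es ge Is gi) (hl : ∀ j ∈ Is, 0 ≤ lamI j) :
    eval x (Rloc Es ge Is gi F lamE lamI K) ≤ eval x F := by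
  simp only [Rloc, map_sub, map_sum, map_mul, eval_C, map_pow, map_one]
  rw [Finset.sum_eq_zero fun j hj => by rw [hx.1 j hj, mul_zero]]
  have : 0 ≤ ∑ j ∈ Is, lamI j * (1 - K * eval x (gi j)) ^ 2 * eval x (gi j) :=
    Finset.sum_nonneg fun j hj =>
      mul_nonneg (mul_nonneg (hl j hj) (sq_nonneg _)) (hx.2 j hj)
  linarith

lemma finite_min {Es : Finset ι} {ge : ι → RPoly N} {Is : Finset κ} {gi : κ → RPoly N}
    {F : RPoly N} (hX : IsCompact (Feas Es ge Is gi))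
    (hopt : ∀ u ∈ Feas Es ge Is gi, eval u F = 0 → OptCondsAt Es ge Is gi F u) :
    ∃ S : Finset (Fin N → ℝ), ∀ u, u ∈ S ↔ u ∈ Feas Es ge Is gi ∧ eval u F = 0 := by
  classical
  let S0 := Feas Es ge Is gi ∩ {u | eval u F = 0}
  have hS0 : IsCompact S0 := hX.inter_right (isClosed_eq (MvPolynomial.continuous_eval _) continuous_const)
  have hiso : ∀ u ∈ S0, {x | x ≠ u → x ∈ Feas Es ge Is gi → 0 < eval x F} ∈ nhds u := by
    rintro u ⟨hu, hF⟩
    obtain ⟨_, lamE, lamI, kkt, hcomp, scc, sosc⟩ := hopt u hu hF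
    obtain ⟨C0, hC0⟩ := local_pd hu.1 hF kkt hcomp scc sosc
    have := (hC0 C0 le_rfl).near
    filter_upwards [this] with x hx hne hxX
    exact (hx hne).trans_le (eval_Rloc_le hxX fun j hj => (hcomp j hj).1)
  obtain ⟨t, ht, hcov⟩ := hS0.elim_nhds_subcover _ hiso
  refine ⟨t, fun u => ⟨fun hu => ht u hu, fun hu => ?_⟩⟩
  obtain ⟨v, hv, huv⟩ := Set.mem_iUnion₂.mp (hcov hu)
  by_cases h : u = v
  · rwa [h]
  · have h1 := huv h hu.1
    rw [hu.2] at h1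
    exact absurd h1 (lt_irrefl _)

lemma one_sub_pow_mem {I : Ideal (RPoly N)} {ψ : RPoly N} (h : ψ ∈ I) (M : ℕ) :
    (1 - ψ) ^ M - 1 ∈ I := by
  have h1 : (1 - ψ) - 1 ∣ (1 - ψ) ^ M - 1 ^ M := sub_dvd_pow_sub_pow _ _ _
  rw [one_pow] at h1
  refine Ideal.mem_of_dvd I h1 ?_
  have := I.neg_mem h
  convert this using 1; ring

lemma certificate {Es : Finset ι} {ge : ι → RPoly N} {Is : Finset κ} {gi : κ → RPoly N}
    {F : RPoly N} (j0 : ι) (hj0 : j0 ∈ Es) (hge : ge j0 = ∑ i, (X i : RPoly N) ^ 2 - 1)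
    (hFX : ∀ x ∈ Feas Es ge Is gi, 0 ≤ eval x F)
    (hopt : ∀ u ∈ Feas Es ge Is gi, eval u F = 0 → OptCondsAt Es ge Is gi F u) :
    ∃ S : Finset (Fin N → ℝ), (∀ u, u ∈ S ↔ u ∈ Feas Es ge Is gi ∧ eval u F = 0) ∧
      ∀ p : RPoly N, (∀ u ∈ S, eval u p = 0) →
        ∃ κ : ℝ, 0 < κ ∧ InQ Es ge Is gi (F - C κ * p ^ 2) := by
  classical
  have hX : IsCompact (Feas Es ge Is gi) := Feas.isCompact j0 hj0 hge
  have cont := fun p : RPoly N => MvPolynomial.continuous_eval p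
  obtain ⟨S, hS⟩ := finite_min hX hopt
  refine ⟨S, hS, fun p hp => ?_⟩
  choose! lamE lamI kkt hcomp scc sosc using fun u (hu : u ∈ S) =>
    (hopt u ((hS u).mp hu).1 ((hS u).mp hu).2).2
  choose! C0 hC0 using fun u (hu : u ∈ S) =>
    local_pd ((hS u).mp hu).1.1 ((hS u).mp hu).2 (kkt u hu) (hcomp u hu) (scc u hu) (sosc u hu)
  obtain ⟨K, hK⟩ := (S.image C0).exists_le
  have hloc0 : ∀ u ∈ S, LocPD u (Rloc Es ge Is gi F (lamE u) (lamI u) K) :=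
    fun u hu => hC0 u hu K (hK _ (Finset.mem_image_of_mem _ hu))
  choose r hr using fun j => interp S (fun u => Real.sqrt (lamI u j))
  choose nn hnn using fun j => interp S (fun u => lamE u j)
  let ψ : RPoly N := ∏ v ∈ S, dsq v
  have hψmem : ∀ u ∈ S, ψ ∈ mI u ^ 2 := fun u hu => by
    refine Ideal.mem_of_dvd _ (Finset.dvd_prod_of_mem _ hu) (dsq_mem u)
  have hψ0 : ∀ x, 0 ≤ eval x ψ := fun x => by
    rw [map_prod]
    exact Finset.prod_nonneg fun v _ => by
      rw [eval_dsq]; exact Finset.sum_nonneg fun _ _ => sq_nonneg _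
  have hψpos : ∀ x, x ∉ S → 0 < eval x ψ := fun x hx => by
    rw [map_prod]
    refine Finset.prod_pos fun v hv => ?_
    rw [eval_dsq]
    exact sq_dist_pos fun h => hx (h ▸ hv)
  obtain ⟨B, hB, hBX⟩ := cbd hX (cont ψ)
  obtain ⟨δ, hδ, hψ1⟩ : ∃ δ : ℝ, 0 < δ ∧ ∀ x ∈ Feas Es ge Is gi, δ * eval x ψ ≤ 1 / 2 := by
    refine ⟨1 / (2 * B), by positivity, fun x hx => ?_⟩
    have := (le_abs_self _).trans (hBX x hx)
    rw [div_mul_eq_mul_div, div_le_div_iff₀ (by positivity) (by positivity)]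
    linarith
  let e : ℕ → RPoly N := fun M => (1 - C δ * ψ) ^ M
  have he : ∀ M, ∀ u ∈ S, e M - 1 ∈ mI u ^ 2 := fun M u hu =>
    one_sub_pow_mem (Ideal.mul_mem_left _ _ (hψmem u hu)) M
  let G : RPoly N := ∑ j ∈ Is, (r j * (1 - C K * gi j)) ^ 2 * gi j
  let Em : RPoly N := ∑ j ∈ Es, (nn j - C K * ge j) * ge j
  let R : ℕ → RPoly N := fun M => F - Em - e M ^ 2 * G
  have hEm : ∀ x ∈ Feas Es ge Is gi, eval x Em = 0 := fun x hx => by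
    simp only [Em, map_sum, map_mul]
    exact Finset.sum_eq_zero fun j hj => by rw [hx.1 j hj, mul_zero]
  have hG0 : ∀ x ∈ Feas Es ge Is gi, 0 ≤ eval x G := fun x hx => by
    simp only [G, map_sum, map_mul, map_pow]
    exact Finset.sum_nonneg fun j hj => mul_nonneg (sq_nonneg _) (hx.2 j hj)
  have hRe : ∀ M, ∀ x ∈ Feas Es ge Is gi,
      eval x (R M) = eval x F - eval x (e M) ^ 2 * eval x G := fun M x hx => by
    simp only [R, map_sub, map_mul, map_pow, hEm x hx, sub_zero]
  have hlocR : ∀ M, ∀ u ∈ S, LocPD u (R M) := by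
    intro M u hu
    refine (hloc0 u hu).congr ?_
    have h1 : ∀ j ∈ Es, (nn j - C (lamE u j)) * ge j ∈ mI u ^ 3 := fun j hj => by
      rw [mul_comm]
      exact mul3 (mem_mI.mpr (((hS u).mp hu).1.1 j hj)) (hnn j u hu)
    have h2 : ∀ j ∈ Is, (e M ^ 2 * r j ^ 2 - C (lamI u j)) * (1 - C K * gi j) ^ 2 * gi j ∈ mI u ^ 3 := by
      intro j hj
      have hz : e M ^ 2 * r j ^ 2 - C (lamI u j) ∈ mI u ^ 2 := by
        have t1 := Ideal.mul_mem_left _ ((e M + 1) * r j ^ 2) (he M u hu)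
        have t2 := Ideal.mul_mem_left _ (r j + C (Real.sqrt (lamI u j))) (hr j u hu)
        have t3 : (C (lamI u j) : RPoly N) = C (Real.sqrt (lamI u j)) ^ 2 := by
          rw [← map_pow, Real.sq_sqrt (hcomp u hu j hj).1]
        have := Ideal.add_mem _ t1 t2
        rw [t3]
        convert this using 1; ring
      by_cases hl : lamI u j = 0
      · have t := hr j u hu
        simp only [hl, Real.sqrt_zero, map_zero, sub_zero] at t
        have t2 : r j ^ 2 ∈ mI u ^ 3 := by
          rw [pow_two]
          exact mul3 (Ideal.pow_le_self (by norm_num) t) t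
        have := Ideal.mul_mem_left _ (e M ^ 2 * (1 - C K * gi j) ^ 2 * gi j) t2
        rw [hl, map_zero]
        convert this using 1; ring
      · have hg : eval u (gi j) = 0 := (mul_eq_zero.mp (hcomp u hu j hj).2).resolve_left hl
        have := Ideal.mul_mem_left _ ((1 - C K * gi j) ^ 2) (mul3 (mem_mI.mpr hg) hz)
        convert this using 1; ring
    have := Ideal.neg_mem_iff _ |>.mpr (Ideal.add_mem _ (Ideal.sum_mem _ h1) (Ideal.sum_mem _ h2))
    convert this using 1
    have s1 : Em - ∑ j ∈ Es, (C (lamE u j) - C K * ge j) * ge j = ∑ j ∈ Es, (nn j - C (lamE u j)) * ge j := by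
      simp only [Em, ← Finset.sum_sub_distrib]
      exact Finset.sum_congr rfl fun j _ => by ring
    have s2 : e M ^ 2 * G - ∑ j ∈ Is, C (lamI u j) * (1 - C K * gi j) ^ 2 * gi j
        = ∑ j ∈ Is, (e M ^ 2 * r j ^ 2 - C (lamI u j)) * (1 - C K * gi j) ^ 2 * gi j := by
      simp only [G, Finset.mul_sum, ← Finset.sum_sub_distrib]
      exact Finset.sum_congr rfl fun j _ => by ring
    rw [← s1, ← s2]
    simp only [R, Rloc]; ring
  choose! U hU hUo huU using fun u (hu : u ∈ S) => mem_nhds_iff.mp (hlocR 0 u hu).near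
  let V : Set (Fin N → ℝ) := ⋃ u ∈ S, U u
  have hV : IsOpen V := isOpen_biUnion fun u hu => hUo u hu
  let Y := Feas Es ge Is gi \ V
  have hY : IsCompact Y := hX.diff hV
  have hYS : ∀ x ∈ Y, x ∉ S := fun x hx hxS =>
    hx.2 (Set.mem_biUnion (show x ∈ (S : Set _) from hxS) (huU x hxS))
  have hFpos : ∀ x ∈ Feas Es ge Is gi, x ∉ S → 0 < eval x F := fun x hx hxS =>
    lt_of_le_of_ne (hFX x hx) fun h => hxS ((hS x).mpr ⟨hx, h.symm⟩)
  obtain ⟨ρ, hρ, hρY⟩ := cpos hY (cont F) fun x hx => hFpos x hx.1 (hYS x hx)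
  obtain ⟨ψ0, hψ0p, hψY⟩ := cpos hY (cont ψ) fun x hx => hψpos x (hYS x hx)
  obtain ⟨D, hD, hDX⟩ := cbd hX (cont G)
  have hq0 : 0 < min (δ * ψ0) (1/2) := by positivity
  have hlim : Filter.Tendsto (fun M : ℕ => (1 - min (δ * ψ0) (1/2)) ^ M * D) Filter.atTop (nhds (0 * D)) := by
    refine Filter.Tendsto.mul_const _ (tendsto_pow_atTop_nhds_zero_of_lt_one ?_ ?_)
    · linarith [min_le_right (δ * ψ0) (1/2)]
    · linarith
  rw [zero_mul] at hlim
  obtain ⟨M, hM⟩ := (hlim.eventually (gt_mem_nhds hρ)).exists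
  have he01 : ∀ x ∈ Feas Es ge Is gi, 0 ≤ eval x (e M) ∧ eval x (e M) ≤ 1 := fun x hx => by
    simp only [e, map_pow, map_sub, map_one, map_mul, eval_C]
    have h1 := hψ1 x hx
    have h2 := mul_nonneg hδ.le (hψ0 x)
    exact ⟨pow_nonneg (by linarith) _, pow_le_one₀ (by linarith) (by linarith)⟩
  have hRpos : ∀ x ∈ Feas Es ge Is gi, x ∉ S → 0 < eval x (R M) := by
    intro x hx hxS
    obtain ⟨ha, hb⟩ := he01 x hx
    have hsq : eval x (e M) ^ 2 ≤ eval x (e M) := by nlinarith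
    by_cases hxV : x ∈ V
    · obtain ⟨u, hu, hxu⟩ := Set.mem_iUnion₂.mp hxV
      have h0 : 0 < eval x (R 0) := hU u hu hxu fun h => hxS (h ▸ hu)
      rw [hRe _ x hx] at h0 ⊢
      have h1 : eval x (e 0) = 1 := by simp [e]
      rw [h1] at h0
      have := mul_le_mul_of_nonneg_right (hsq.trans hb) (hG0 x hx)
      linarith
    · have hxY : x ∈ Y := ⟨hx, hxV⟩
      rw [hRe _ x hx]
      have h1 := hρY x hxY
      have h2 := (le_abs_self _).trans (hDX x hx)
      have h3 : eval x (e M) ≤ (1 - min (δ * ψ0) (1/2)) ^ M := by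
        simp only [e, map_pow, map_sub, map_one, map_mul, eval_C]
        refine pow_le_pow_left₀ (by linarith [hψ1 x hx]) ?_ M
        have := min_le_left (δ * ψ0) (1/2)
        have : δ * ψ0 ≤ δ * eval x ψ := mul_le_mul_of_nonneg_left (hψY x hxY) hδ.le
        linarith
      have h4 : eval x (e M) ^ 2 * eval x G ≤ (1 - min (δ * ψ0) (1/2)) ^ M * D :=
        mul_le_mul (hsq.trans h3) h2 (hG0 x hx) (ha.trans h3)
      linarith
  obtain ⟨κ, hκ, hQ⟩ := core hX S (R M) hRpos (hlocR M) InQ.isQM (InQ.of_pos j0 hj0 hge) p hp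
  refine ⟨κ, hκ, ?_⟩
  have hEmQ : InQ Es ge Is gi Em := by
    refine Finset.sum_induction _ (InQ Es ge Is gi) (fun a b ha hb => InQ.add a b ha hb) ?_ fun j hj => ?_
    · exact InQ.isQM.zero
    · rw [mul_comm]; exact InQ.eq j hj _
  have hGQ : InQ Es ge Is gi (e M ^ 2 * G) := by
    refine InQ.isQM.mul _ ?_ _
    refine Finset.sum_induction _ (InQ Es ge Is gi) (fun a b ha hb => InQ.add a b ha hb) ?_ fun j hj => ?_
    · exact InQ.isQM.zero
    · rw [mul_comm]; exact InQ.ineq j hj _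
  have := InQ.add _ _ (InQ.add _ _ hQ hEmQ) hGQ
  convert this using 1
  simp only [R]; ring

end FT

namespace FT

lemma eval_homogAux {n : ℕ} (ℓ : ℕ) (p : RPoly n) (x : Fin (n + 1) → ℝ) :
    eval x (homogAux ℓ p) =
      ∑ α ∈ p.support, p.coeff α * (x 0 ^ (ℓ - mdeg α) * ∏ i, x (Fin.succ i) ^ α i) := by
  unfold homogAux
  rw [map_sum]
  refine Finset.sum_congr rfl fun α _ => ?_
  rw [eval_monomial, Finsupp.prod_add_index' (fun _ => pow_zero _) (fun _ _ _ => pow_add _ _ _),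
    Finsupp.prod_single_index (h := fun i e => x i ^ e) (pow_zero _),
    Finsupp.prod_mapDomain_index_inj (Fin.succ_injective n),
    Finsupp.prod_fintype _ _ (fun _ => pow_zero _)]

lemma mdeg_le {n : ℕ} {p : RPoly n} {α : Fin n →₀ ℕ} (h : α ∈ p.support) :
    mdeg α ≤ p.totalDegree := by
  have := le_totalDegree h
  rwa [Finsupp.sum_fintype _ _ (fun _ => rfl)] at this

lemma homog_pt {n : ℕ} {ℓ : ℕ} {p : RPoly n} (hp : p.totalDegree ≤ ℓ) (r : ℝ) (hr : r ≠ 0)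
    (z : Fin n → ℝ) (x : Fin (n + 1) → ℝ) (h0 : x 0 = r) (hs : ∀ i, x (Fin.succ i) = r * z i) :
    eval x (homogAux ℓ p) = r ^ ℓ * eval z p := by
  rw [eval_homogAux, eval_eq', Finset.mul_sum]
  refine Finset.sum_congr rfl fun α hα => ?_
  have h1 : ∏ i, x (Fin.succ i) ^ α i = r ^ mdeg α * ∏ i, z i ^ α i := by
    unfold mdeg
    rw [← Finset.prod_pow_eq_pow_sum, ← Finset.prod_mul_distrib]
    exact Finset.prod_congr rfl fun i _ => by rw [hs, mul_pow]
  have h2 : r ^ ℓ = r ^ (ℓ - mdeg α) * r ^ mdeg α := by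
    rw [← pow_add, Nat.sub_add_cancel ((mdeg_le hα).trans hp)]
  rw [h1, h2, h0]; ring

lemma homog_dehom {n : ℕ} {ℓ : ℕ} {p : RPoly n} (hp : p.totalDegree ≤ ℓ)
    (x : Fin (n + 1) → ℝ) (h0 : x 0 ≠ 0) :
    eval x (homogAux ℓ p) = x 0 ^ ℓ * eval (fun i => x (Fin.succ i) / x 0) p :=
  homog_pt hp (x 0) h0 _ x rfl fun i => by field_simp

variable {n : ℕ} {E I : Finset ℕ} {c : ℕ → RPoly n}

lemma khom_feas : Khom E I c = Feas (OS E) (gEqH c) (OS I) (gInH c) := by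
  ext x
  simp only [Khom, Feas, OS, Set.mem_ofPred_eq, Finset.mem_insert, Finset.mem_image, forall_eq_or_imp]
  have h1 : eval x (gEqH c none) = ∑ i, x i ^ 2 - 1 := by
    simp [gEqH, sphereP]
  have h2 : eval x (gInH c none) = x 0 := by simp [gInH]
  rw [h1, h2, sub_eq_zero]
  constructor
  · rintro ⟨a, b, c, d⟩
    refine ⟨⟨c, ?_⟩, d, ?_⟩
    · rintro _ ⟨j, hj, rfl⟩; exact a j hj
    · rintro _ ⟨j, hj, rfl⟩; exact b j hj
  · rintro ⟨⟨c, a⟩, d, b⟩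
    exact ⟨fun j hj => a _ ⟨j, hj, rfl⟩, fun j hj => b _ ⟨j, hj, rfl⟩, c, d⟩

lemma dehom_mem {x : Fin (n + 1) → ℝ} (hx : x ∈ Khom E I c) (h0 : 0 < x 0) :
    (fun i => x (Fin.succ i) / x 0) ∈ Kset E I c := by
  obtain ⟨h1, h2, -, -⟩ := hx
  refine ⟨fun j hj => ?_, fun j hj => ?_⟩
  · have := h1 j hj
    rw [homogenize, homog_dehom le_rfl x h0.ne'] at this
    exact (mul_eq_zero.mp this).resolve_left (pow_pos h0 _).ne'
  · have := h2 j hj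
    rw [homogenize, homog_dehom le_rfl x h0.ne'] at this
    exact nonneg_of_mul_nonneg_right this (pow_pos h0 _)

lemma hom_mem {z : Fin n → ℝ} (hz : z ∈ Kset E I c) :
    ∃ r : ℝ, 0 < r ∧ ∃ x ∈ Khom E I c, x 0 = r ∧ ∀ i, x (Fin.succ i) = r * z i := by
  have hpos : 0 < 1 + ∑ i, z i ^ 2 := by positivity
  set r : ℝ := (Real.sqrt (1 + ∑ i, z i ^ 2))⁻¹ with hr
  have hr0 : 0 < r := by positivity
  have hr2 : r ^ 2 * (1 + ∑ i, z i ^ 2) = 1 := by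
    rw [hr, inv_pow, Real.sq_sqrt hpos.le, inv_mul_cancel₀ hpos.ne']
  refine ⟨r, hr0, Fin.cons r (fun i => r * z i), ⟨?_, ?_, ?_, ?_⟩, by simp, fun i => by simp⟩
  · intro j hj
    rw [homogenize, homog_pt le_rfl r hr0.ne' z _ (by simp) (fun i => by simp), hz.1 j hj, mul_zero]
  · intro j hj
    rw [homogenize, homog_pt le_rfl r hr0.ne' z _ (by simp) (fun i => by simp)]
    exact mul_nonneg (by positivity) (hz.2 j hj)
  · rw [Fin.sum_univ_succ]
    simp only [Fin.cons_zero, Fin.cons_succ]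
    rw [← hr2, mul_add, Finset.mul_sum]
    simp [mul_pow]
  · simpa using hr0.le

/-- closure argument -/
lemma nonneg_of_cl (hcl : ClosedAtInfinity E I c) {g : (Fin (n + 1) → ℝ) → ℝ} (hg : Continuous g)
    (h : ∀ x ∈ Khom E I c, 0 < x 0 → 0 ≤ g x) : ∀ x ∈ Khom E I c, 0 ≤ g x := by
  intro x hx
  rw [hcl] at hx
  have hc : IsClosed {x | 0 ≤ g x} := isClosed_le continuous_const hg
  exact closure_minimal (s := Khom E I c ∩ {x | 0 < x 0}) (fun y hy => h y hy.1 hy.2) hc hx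

variable {m d : ℕ} {f : RPoly n} {a : Fin m → RPoly n}

/-- homogenized objective -/
noncomputable def FF (d : ℕ) (f : RPoly n) (a : Fin m → RPoly n) (θ : Fin m → ℝ) : RPoly (n + 1) :=
  homogAux d f - ∑ i, C (θ i) * homogAux d (a i)

lemma eval_FF (hf : f.totalDegree ≤ d) (ha : ∀ i, (a i).totalDegree ≤ d) (θ : Fin m → ℝ)
    (r : ℝ) (hr : r ≠ 0)
    (z : Fin n → ℝ) (x : Fin (n + 1) → ℝ) (h0 : x 0 = r) (hs : ∀ i, x (Fin.succ i) = r * z i) :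
    eval x (FF d f a θ) = r ^ d * eval z (f - ∑ i, C (θ i) * a i) := by
  simp only [FF, map_sub, map_sum, map_mul, eval_C]
  rw [homog_pt hf r hr z x h0 hs, mul_sub, Finset.mul_sum]
  congr 1
  refine Finset.sum_congr rfl fun i _ => ?_
  rw [homog_pt (ha i) r hr z x h0 hs]; ring

lemma deg_le (hf : f.totalDegree ≤ d) (ha : ∀ i, (a i).totalDegree ≤ d) (θ : Fin m → ℝ) :
    (f - ∑ i, C (θ i) * a i).totalDegree ≤ d := by
  refine (totalDegree_sub _ _).trans (max_le hf (totalDegree_finsetSum_le fun i _ => ?_))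
  refine (totalDegree_mul _ _).trans ?_
  rw [totalDegree_C, zero_add]; exact ha i

lemma FF_nonneg_iff (hf : f.totalDegree ≤ d) (ha : ∀ i, (a i).totalDegree ≤ d)
    (hcl : ClosedAtInfinity E I c) (θ : Fin m → ℝ) :
    (f - ∑ i, C (θ i) * a i) ∈ PdCone d (Kset E I c) ↔
      ∀ x ∈ Khom E I c, 0 ≤ eval x (FF d f a θ) := by
  constructor
  · rintro ⟨-, h⟩
    refine nonneg_of_cl hcl (continuous_eval _) fun x hx h0 => ?_
    rw [eval_FF hf ha θ (x 0) h0.ne' (fun i => x (Fin.succ i) / x 0) x rfl (fun i => by field_simp)]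
    exact mul_nonneg (by positivity) (h _ (dehom_mem hx h0))
  · intro h
    refine ⟨deg_le hf ha θ, fun z hz => ?_⟩
    obtain ⟨r, hr, x, hx, h0, hs⟩ := hom_mem hz
    have := h x hx
    rw [eval_FF hf ha θ r hr.ne' z x h0 hs] at this
    exact nonneg_of_mul_nonneg_right this (pow_pos hr _)

lemma FF_pos (hf : f.totalDegree ≤ d) (ha : ∀ i, (a i).totalDegree ≤ d)
    (hcl : ClosedAtInfinity E I c) (θ : Fin m → ℝ)
    (h : (f - ∑ i, C (θ i) * a i) ∈ PdInterior d (Kset E I c)) :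
    ∀ x ∈ Khom E I c, 0 < eval x (FF d f a θ) := by
  obtain ⟨hd, ε, hε, h⟩ := h
  have key : ∀ (s : ℝ), |s| = 1 → ∀ j : Fin (n + 1), ∀ x ∈ Khom E I c,
      0 ≤ eval x (FF d f a θ) - s * ε * x j ^ d := by
    intro s hs j
    refine nonneg_of_cl hcl ((continuous_eval _).sub (by fun_prop)) fun x hx h0 => ?_
    rw [eval_FF hf ha θ (x 0) h0.ne' (fun i => x (Fin.succ i) / x 0) x rfl (fun i => by field_simp)]
    have hmem := dehom_mem hx h0
    have aux : ∀ β : Fin n →₀ ℕ, mdeg β ≤ d →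
        0 ≤ eval (fun i => x (Fin.succ i) / x 0)
          ((f - ∑ i, C (θ i) * a i) - monomial β (s * ε)) := by
      intro β hβ
      refine h _ ?_ ?_ _ hmem
      · refine (totalDegree_sub _ _).trans (max_le hd ((totalDegree_monomial_le _ _).trans ?_))
        rwa [Finsupp.sum_fintype _ _ (fun _ => rfl)]
      · intro α
        classical
        rw [coeff_sub, sub_sub_cancel_left, abs_neg, coeff_monomial]
        split_ifs
        · rw [abs_mul, hs, one_mul, abs_of_pos hε]
        · simpa using hε.le
    have hx0 : 0 < x 0 ^ d := pow_pos h0 d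
    induction j using Fin.cases with
    | zero =>
      have := aux 0 (by simp [mdeg])
      rw [map_sub, eval_monomial] at this
      simp only [Finsupp.prod_zero_index, mul_one] at this
      nlinarith
    | succ i =>
      have := aux (Finsupp.single i d) (by
        unfold mdeg
        rw [Finset.sum_eq_single i] <;> simp +contextual [Finsupp.single_apply, eq_comm])
      rw [map_sub, eval_monomial, Finsupp.prod_single_index (h := fun i e => (x (Fin.succ i) / x 0) ^ e) (pow_zero _), div_pow] at this
      have h3 := mul_nonneg hx0.le this
      have h4 : x 0 ^ d * (x (Fin.succ i) ^ d / x 0 ^ d) = x (Fin.succ i) ^ d := by field_simp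
      rw [mul_sub, mul_left_comm, h4] at h3
      exact h3
  intro x hx
  have hne : ∃ j, x j ≠ 0 := by
    by_contra hcon
    push Not at hcon
    have := hx.2.2.1
    simp [hcon] at this
  obtain ⟨j, hj⟩ := hne
  have h1 := key 1 (by simp) j x hx
  have h2 := key (-1) (by simp) j x hx
  have h3 : 0 < ε * |x j ^ d| := mul_pos hε (abs_pos.mpr (pow_ne_zero _ hj))
  rcases abs_cases (x j ^ d) with h4 | h4 <;> rw [h4.1] at h3 <;> linarith

end FT

namespace FT
variable {N m : ℕ}

lemma duality {X : Set (Fin N → ℝ)} (hX : IsCompact X) (m1 : ℕ) (fh : RPoly N) (ah : Fin m → RPoly N)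
    (b θs θ1 : Fin m → ℝ) (hs0 : ∀ i : Fin m, m1 ≤ (i : ℕ) → 0 ≤ θs i)
    (hs : ∀ x ∈ X, 0 ≤ eval x (fh - ∑ i, C (θs i) * ah i))
    (hmax : ∀ θ : Fin m → ℝ, (∀ i : Fin m, m1 ≤ (i : ℕ) → 0 ≤ θ i) →
      (∀ x ∈ X, 0 ≤ eval x (fh - ∑ i, C (θ i) * ah i)) → ∑ i, b i * θ i ≤ ∑ i, b i * θs i)
    (h10 : ∀ i : Fin m, m1 ≤ (i : ℕ) → 0 < θ1 i)
    (h1 : ∀ x ∈ X, 0 < eval x (fh - ∑ i, C (θ1 i) * ah i)) :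
    ∃ L : RPoly N →ₗ[ℝ] ℝ, (∀ p, (∀ x ∈ X, 0 ≤ eval x p) → 0 ≤ L p) ∧
      (∀ i : Fin m, (i : ℕ) < m1 → L (ah i) = b i) ∧
      (∀ i : Fin m, m1 ≤ (i : ℕ) → b i ≤ L (ah i)) ∧ L fh ≤ ∑ i, b i * θs i := by
  classical
  let s : PointedCone ℝ (RPoly N × (Fin m → ℝ) × ℝ) :=
    { carrier := {e | (∀ x ∈ X, 0 ≤ eval x e.1) ∧ (∀ i : Fin m, m1 ≤ (i : ℕ) → 0 ≤ e.2.1 i) ∧ 0 ≤ e.2.2}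
      add_mem' := by
        rintro e e' ⟨h1, h2, h3⟩ ⟨h1', h2', h3'⟩
        refine ⟨fun x hx => ?_, fun i hi => add_nonneg (h2 i hi) (h2' i hi), add_nonneg h3 h3'⟩
        rw [Prod.fst_add, map_add]; exact add_nonneg (h1 x hx) (h1' x hx)
      zero_mem' := by
        refine ⟨fun x hx => ?_, fun i hi => le_rfl, le_rfl⟩
        simp
      smul_mem' := by
        rintro ⟨r, hr⟩ e ⟨h1, h2, h3⟩
        refine ⟨fun x hx => ?_, fun i hi => mul_nonneg hr (h2 i hi), mul_nonneg hr h3⟩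
        show 0 ≤ eval x (r • e.1)
        rw [smul_eval]; exact mul_nonneg hr (h1 x hx) }
  have hsmem : ∀ e : (RPoly N × (Fin m → ℝ) × ℝ), e ∈ s ↔ (∀ x ∈ X, 0 ≤ eval x e.1) ∧ (∀ i : Fin m, m1 ≤ (i : ℕ) → 0 ≤ e.2.1 i) ∧ 0 ≤ e.2.2 :=
    fun e => Iff.rfl
  let φ : (RPoly N × (Fin m → ℝ) × ℝ) →ₗ[ℝ] RPoly N :=
    { toFun := fun e => e.1 - (C e.2.2 * fh - ∑ i, C (e.2.1 i) * ah i)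
      map_add' := by
        intro e e'
        simp only [Prod.fst_add, Prod.snd_add, Pi.add_apply, map_add, add_mul, Finset.sum_add_distrib]
        ring
      map_smul' := by
        intro r e
        simp only [Prod.smul_fst, Prod.smul_snd, Pi.smul_apply, smul_eq_mul, map_mul, RingHom.id_apply,
          mul_assoc, ← Finset.mul_sum, smul_eq_C_mul]
        ring }
  let ℓ : (RPoly N × (Fin m → ℝ) × ℝ) →ₗ[ℝ] ℝ :=
    { toFun := fun e => e.2.2 * (∑ i, b i * θs i) - ∑ i, b i * e.2.1 i
      map_add' := by
        intro e e'
        simp only [Prod.snd_add, Prod.fst_add, Pi.add_apply, mul_add, Finset.sum_add_distrib]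
        ring
      map_smul' := by
        intro r e
        simp only [Prod.smul_fst, Prod.smul_snd, Pi.smul_apply, smul_eq_mul, RingHom.id_apply, mul_sub, Finset.mul_sum]
        congr 1
        · exact Finset.sum_congr rfl fun i _ => by ring
        · exact Finset.sum_congr rfl fun i _ => by ring }
  have hφ : ∀ e : (RPoly N × (Fin m → ℝ) × ℝ), e ∈ LinearMap.ker φ ↔ e.1 = C e.2.2 * fh - ∑ i, C (e.2.1 i) * ah i := by
    intro e; rw [LinearMap.mem_ker]; exact sub_eq_zero
  obtain ⟨g, hg1, hg2⟩ := riesz_extension s ⟨LinearMap.ker φ, ℓ.domRestrict (LinearMap.ker φ)⟩ (by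
    rintro ⟨⟨p, t, τ⟩, he⟩ hes
    replace he := (hφ _).mp he
    obtain ⟨e1, e2, e3⟩ := (hsmem _).mp hes
    simp only at he e1 e2 e3
    show 0 ≤ τ * (∑ i, b i * θs i) - ∑ i, b i * t i
    rcases e3.eq_or_lt with h0 | h0
    · have := hmax (θs + t) (fun i hi => add_nonneg (hs0 i hi) (e2 i hi)) (fun x hx => by
        have k1 := hs x hx
        have k2 := e1 x hx
        rw [he, ← h0] at k2
        simp only [map_sub, map_sum, map_mul, eval_C, Pi.add_apply, add_mul, Finset.sum_add_distrib, zero_mul] at k1 k2 ⊢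
        linarith)
      simp only [Pi.add_apply, mul_add, Finset.sum_add_distrib] at this
      rw [← h0]; linarith
    · have := hmax (fun i => t i / τ) (fun i hi => div_nonneg (e2 i hi) h0.le) (fun x hx => by
        have k2 := e1 x hx
        rw [he] at k2
        simp only [map_sub, map_sum, map_mul, eval_C] at k2 ⊢
        have : ∑ i, t i / τ * eval x (ah i) = (∑ i, t i * eval x (ah i)) / τ := by
          rw [Finset.sum_div]; exact Finset.sum_congr rfl fun i _ => by ring
        rw [this, sub_nonneg, div_le_iff₀ h0]; linarith)
      have h5 : ∑ i, b i * (t i / τ) = (∑ i, b i * t i) / τ := by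
        rw [Finset.sum_div]; exact Finset.sum_congr rfl fun i _ => by ring
      rw [h5, div_le_iff₀ h0] at this
      linarith) (by
    rintro ⟨p, t, τ⟩
    obtain ⟨ρ, hρ, hρ'⟩ := cpos hX (continuous_eval _) h1
    obtain ⟨B, hB, hB'⟩ := cbd hX (continuous_eval p)
    have hev : ∀ᶠ M : ℝ in Filter.atTop, 0 ≤ M ∧ 0 ≤ M * ρ + -B ∧ 0 ≤ M + τ ∧
        ∀ i : Fin m, m1 ≤ (i : ℕ) → 0 ≤ M * θ1 i + t i := by
      have aux : ∀ r : ℝ, 0 < r → ∀ q : ℝ, ∀ᶠ M : ℝ in Filter.atTop, 0 ≤ M * r + q := by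
        intro r hr q
        filter_upwards [Filter.eventually_ge_atTop ((-q) / r)] with M hM
        rw [div_le_iff₀ hr] at hM; linarith
      refine (Filter.eventually_ge_atTop 0).and ((aux ρ hρ _).and (Filter.Eventually.and ?_ ?_))
      · simpa using aux 1 one_pos τ
      · rw [Filter.eventually_all]
        intro i
        by_cases hi : m1 ≤ (i : ℕ)
        · filter_upwards [aux _ (h10 i hi) (t i)] with M hM _ using hM
        · exact Filter.Eventually.of_forall fun M h => absurd h hi
    obtain ⟨M, hM0, hM1, hM2, hM3⟩ := hev.exists
    refine ⟨⟨(C M * (fh - ∑ i, C (θ1 i) * ah i), fun i => M * θ1 i, M), (hφ _).mpr ?_⟩, (hsmem _).mpr ⟨fun x hx => ?_, fun i hi => hM3 i hi, hM2⟩⟩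
    · simp only [mul_sub, Finset.mul_sum, map_mul, mul_assoc]
    · show 0 ≤ eval x (C M * (fh - ∑ i, C (θ1 i) * ah i) + p)
      rw [map_add, map_mul, eval_C]
      have k1 := mul_le_mul_of_nonneg_left (hρ' x hx) hM0
      have k2 := (abs_le.mp (hB' x hx)).1
      linarith)
  have hg3 : ∀ e : (RPoly N × (Fin m → ℝ) × ℝ), e.1 = C e.2.2 * fh - ∑ i, C (e.2.1 i) * ah i →
      g e = e.2.2 * (∑ i, b i * θs i) - ∑ i, b i * e.2.1 i := fun e he => hg1 ⟨e, (hφ e).mpr he⟩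
  have hsplit : ∀ p t τ, g ((p, t, τ) : (RPoly N × (Fin m → ℝ) × ℝ)) = g ((p, 0, 0) : (RPoly N × (Fin m → ℝ) × ℝ)) + g ((0, t, τ) : (RPoly N × (Fin m → ℝ) × ℝ)) := by
    intro p t τ
    rw [← map_add]; simp
  have hi1 : ∀ i, g ((ah i, 0, 0) : (RPoly N × (Fin m → ℝ) × ℝ)) = b i + g ((0, Pi.single i 1, 0) : (RPoly N × (Fin m → ℝ) × ℝ)) := by
    intro i
    have k := hg3 (-ah i, Pi.single i 1, 0) (by
      simp only [map_zero, zero_mul, zero_sub, neg_inj]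
      rw [Finset.sum_eq_single i] <;> simp +contextual [Pi.single_apply])
    rw [hsplit] at k
    have k2 : g ((-ah i, 0, 0) : (RPoly N × (Fin m → ℝ) × ℝ)) = - g ((ah i, 0, 0) : (RPoly N × (Fin m → ℝ) × ℝ)) := by
      rw [← map_neg]; simp
    have k3 : ∑ j, b j * (Pi.single i 1 : Fin m → ℝ) j = b i := by
      rw [Finset.sum_eq_single i] <;> simp +contextual [Pi.single_apply]
    simp only [k3, k2] at k
    linarith
  refine ⟨g.comp (LinearMap.inl ℝ _ _), fun p hp => ?_, fun i hi => ?_, fun i hi => ?_, ?_⟩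
  · exact hg2 _ ((hsmem _).mpr ⟨hp, fun i _ => le_rfl, le_rfl⟩)
  · show g ((ah i, 0, 0) : (RPoly N × (Fin m → ℝ) × ℝ)) = b i
    have k : ∀ r : ℝ, 0 ≤ g ((0, Pi.single i r, 0) : (RPoly N × (Fin m → ℝ) × ℝ)) := by
      intro r
      refine hg2 _ ((hsmem _).mpr ⟨fun x hx => by simp, fun j hj => ?_, le_rfl⟩)
      have : j ≠ i := by rintro rfl; omega
      simp [Pi.single_apply, this]
    have k2 : g ((0, Pi.single i (-1), 0) : (RPoly N × (Fin m → ℝ) × ℝ)) = - g ((0, Pi.single i 1, 0) : (RPoly N × (Fin m → ℝ) × ℝ)) := by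
      rw [← map_neg]; simp [Pi.single_neg]
    have := k 1
    have := k (-1)
    rw [hi1]; linarith
  · show b i ≤ g ((ah i, 0, 0) : (RPoly N × (Fin m → ℝ) × ℝ))
    have : 0 ≤ g ((0, Pi.single i 1, 0) : (RPoly N × (Fin m → ℝ) × ℝ)) := by
      refine hg2 _ ((hsmem _).mpr ⟨fun x hx => by simp, fun j hj => ?_, le_rfl⟩)
      show 0 ≤ (Pi.single i 1 : Fin m → ℝ) j
      rw [Pi.single_apply]; split_ifs <;> simp
    rw [hi1]; linarith
  · show g ((fh, 0, 0) : (RPoly N × (Fin m → ℝ) × ℝ)) ≤ _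
    have k := hg3 (fh, 0, 1) (by simp)
    rw [hsplit] at k
    have : 0 ≤ g ((0, 0, 1) : (RPoly N × (Fin m → ℝ) × ℝ)) := hg2 _ ((hsmem _).mpr ⟨fun x hx => by simp, fun j hj => le_rfl, zero_le_one⟩)
    simp at k
    linarith

end FT

namespace FT
variable {N m : ℕ}

lemma flat_rank (S : Finset (Fin N → ℝ)) (e : (Fin N → ℝ) → RPoly N)
    (he1 : ∀ u ∈ S, eval u (e u) = 1) (he0 : ∀ u ∈ S, ∀ v ∈ S, v ≠ u → eval v (e u) = 0)
    (t : ℕ) (hD : ∀ u ∈ S, (e u).totalDegree ≤ t) (w : (Fin N →₀ ℕ) → ℝ) (Λ : (Fin N → ℝ) → ℝ)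
    (hw : ∀ α, mdeg α ≤ 2 * t → w α = ∑ u ∈ S, (∏ i, u i ^ α i) * Λ u) :
    (momentMatrix t w).rank = (Matrix.diagonal (fun u : S => Λ u)).rank := by
  classical
  let V : Matrix S {α : Fin N →₀ ℕ // mdeg α ≤ t} ℝ := fun u α => ∏ i, u.1 i ^ α.1 i
  let W : Matrix {α : Fin N →₀ ℕ // mdeg α ≤ t} S ℝ := fun α u => (e u.1).coeff α.1
  have hVW : V * W = 1 := by
    ext u v
    have h1 : (V * W) u v = eval u.1 (e v.1) := by
      rw [Matrix.mul_apply, eval_eq']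
      let s : Finset (Fin N →₀ ℕ) := Finset.univ.map (Function.Embedding.subtype fun α => mdeg α ≤ t)
      have hs : (e v.1).support ⊆ s := by
        intro α hα
        simp only [s, Finset.mem_map, Finset.mem_univ, true_and, Function.Embedding.subtype_apply]
        exact ⟨⟨α, (mdeg_le hα).trans (hD _ v.2)⟩, rfl⟩
      rw [Finset.sum_subset hs (fun α _ hα => by rw [notMem_support_iff.mp hα, zero_mul])]
      rw [Finset.sum_map]
      exact Finset.sum_congr rfl fun α _ => mul_comm _ _
    rw [h1, Matrix.one_apply]
    split_ifs with h
    · subst h; exact he1 _ u.2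
    · exact he0 _ v.2 _ u.2 fun h' => h (Subtype.ext h')
  have hM : momentMatrix t w = V.transpose * Matrix.diagonal (fun u : S => Λ u) * V := by
    ext α β
    rw [Matrix.mul_apply]
    simp only [Matrix.mul_diagonal, Matrix.transpose_apply]
    show w (α.1 + β.1) = _
    rw [hw _ (by
      have h3 : mdeg (α.1 + β.1) = mdeg α.1 + mdeg β.1 := by
        simp [mdeg, Finset.sum_add_distrib]
      have := α.2
      have := β.2
      omega), ← Finset.sum_coe_sort S]
    refine Finset.sum_congr rfl fun u _ => ?_
    have : ∏ i, u.1 i ^ (α.1 + β.1) i = V u α * V u β := by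
      simp only [V, ← Finset.prod_mul_distrib, Finsupp.add_apply, pow_add]
    rw [this]; ring
  have hW : W.transpose * momentMatrix t w * W = Matrix.diagonal (fun u : S => Λ u) := by
    have h2 : W.transpose * V.transpose = 1 := by rw [← Matrix.transpose_mul, hVW, Matrix.transpose_one]
    rw [hM]
    calc _ = (W.transpose * V.transpose) * Matrix.diagonal (fun u : S => Λ u) * (V * W) := by
          simp only [Matrix.mul_assoc]
      _ = _ := by rw [h2, hVW, Matrix.one_mul, Matrix.mul_one]
  apply le_antisymm
  · rw [hM]
    exact (Matrix.rank_mul_le_left _ _).trans (Matrix.rank_mul_le_right _ _)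
  · rw [← hW]
    exact (Matrix.rank_mul_le_left _ _).trans (Matrix.rank_mul_le_right _ _)

variable {ι κ : Type} {Es : Finset ι} {ge : ι → RPoly N} {Is : Finset κ} {gi : κ → RPoly N}

lemma null_of {k : ℕ} {w : (Fin N →₀ ℕ) → ℝ} (hw : MomRelaxPSD Es ge Is gi k w) {F p : RPoly N}
    (hp : p.totalDegree ≤ k) (hF : pl w F ≤ 0) {r : ℝ} (hr : 0 < r)
    (h : 0 ≤ pl w (F - C r * p ^ 2)) : pl w p = 0 := by
  rw [map_sub, pl_C_mul] at h
  have h0 : pl w (p ^ 2) ≤ 0 := by nlinarith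
  have h1 : ∀ t : ℝ, 0 ≤ pl w (p ^ 2) + 2 * t * pl w p + t ^ 2 * pl w 1 := by
    intro t
    have h2 := hw.2.2 (p + C t) ((totalDegree_add _ _).trans (max_le hp (by simp)))
    rw [← pl_apply] at h2
    have h3 : (p + C t) ^ 2 = p ^ 2 + C (2 * t) * p + C (t ^ 2) * 1 := by
      simp only [map_mul, map_pow, map_ofNat C 2]; ring
    rw [h3, map_add, map_add, pl_C_mul, pl_C_mul] at h2
    exact h2
  have h1' : ∀ t : ℝ, 0 ≤ 2 * t * pl w p + t ^ 2 * pl w 1 := fun t => by have := h1 t; linarith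
  set x := pl w p
  set y := pl w 1
  have hy : 0 ≤ y := by have := h1' 1; have := h1' (-1); linarith
  have := h1' (-x / (y + 1))
  have h5 : 2 * (-x / (y + 1)) * x + (-x / (y + 1)) ^ 2 * y = - (x ^ 2 * (y + 2) / (y + 1) ^ 2) := by
    field_simp; ring
  rw [h5] at this
  by_contra hx
  have : 0 < x ^ 2 * (y + 2) / (y + 1) ^ 2 := by
    have : 0 < x ^ 2 := by positivity
    positivity
  linarith

/-- the abstract finishing step -/
lemma finish (j0 : ι) (hj0 : j0 ∈ Es) (hge : ge j0 = ∑ i, (X i : RPoly N) ^ 2 - 1) {F : RPoly N}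
    (hFX : ∀ x ∈ Feas Es ge Is gi, 0 ≤ eval x F)
    (hopt : ∀ u ∈ Feas Es ge Is gi, eval u F = 0 → OptCondsAt Es ge Is gi F u) (d0 dK : ℕ) :
    ∃ k1 : ℕ, ∀ k, k1 ≤ k → ∀ w, MomRelaxPSD Es ge Is gi k w → pl w F ≤ 0 →
      HasFlatTruncation d0 dK k w := by
  classical
  obtain ⟨S, -, hcert⟩ := certificate j0 hj0 hge hFX hopt
  choose e he1 he0 using fun u => lagrange S u
  set D := S.sup fun u => (e u).totalDegree with hDdef
  have hD : ∀ u ∈ S, (e u).totalDegree ≤ D := fun u hu =>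
    Finset.le_sup (f := fun u => (e u).totalDegree) hu
  set T := D + dK + d0
  let P : (Fin N →₀ ℕ) → RPoly N := fun α =>
    monomial α 1 - ∑ u ∈ S, C (∏ i, u i ^ α i) * e u
  have hP : ∀ α, ∀ v ∈ S, eval v (P α) = 0 := by
    intro α v hv
    simp only [P, map_sub, map_sum, map_mul, eval_C, eval_monomial, one_mul]
    rw [Finset.sum_eq_single v, he1, mul_one, Finsupp.prod_fintype _ _ (fun _ => pow_zero _), sub_self]
    · intro u _ huv
      rw [he0 u v hv huv.symm, mul_zero]
    · exact fun h => absurd hv h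
  have hk : ∀ α, ∃ k0, ∀ k, k0 ≤ k → ∀ w, MomRelaxPSD Es ge Is gi k w → pl w F ≤ 0 → pl w (P α) = 0 := by
    intro α
    obtain ⟨r, hr, hQ⟩ := hcert (P α) (hP α)
    obtain ⟨k0, hk0⟩ := hQ.nonneg
    refine ⟨max k0 (P α).totalDegree, fun k hk w hw hF => ?_⟩
    exact null_of hw ((le_max_right _ _).trans hk) hF hr (hk0 k ((le_max_left _ _).trans hk) w hw)
  choose K hK using hk
  let A : Finset (Fin N →₀ ℕ) := Finset.univ.map (Function.Embedding.subtype fun α => mdeg α ≤ 2 * T)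
  refine ⟨max T (A.sup K), fun k hk w hw hF => ⟨T, by omega, (le_max_left _ _).trans hk, ?_⟩⟩
  have hwα : ∀ α, mdeg α ≤ 2 * T → w α = ∑ u ∈ S, (∏ i, u i ^ α i) * pl w (e u) := by
    intro α hα
    have hA : α ∈ A := by
      simp only [A, Finset.mem_map, Finset.mem_univ, true_and, Function.Embedding.subtype_apply]
      exact ⟨⟨α, hα⟩, rfl⟩
    have := hK α k ((Finset.le_sup hA).trans ((le_max_right _ _).trans hk)) w hw hF
    simp only [P, map_sub, map_sum, pl_C_mul, pl_monomial, one_mul] at this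
    linarith
  rw [flat_rank S e (fun u _ => he1 u) (fun u _ v hv h => he0 u v hv h) (T - dK)
      (fun u hu => (hD u hu).trans (by omega)) w (fun u => pl w (e u)) (fun α hα => hwα α (by omega)),
    flat_rank S e (fun u _ => he1 u) (fun u _ v hv h => he0 u v hv h) T
      (fun u hu => (hD u hu).trans (by omega)) w (fun u => pl w (e u)) (fun α hα => hwα α (by omega))]

lemma psd_of_lin (L : RPoly N →ₗ[ℝ] ℝ) (hL : ∀ p, (∀ x ∈ Feas Es ge Is gi, 0 ≤ eval x p) → 0 ≤ L p) :
    ∃ w : (Fin N →₀ ℕ) → ℝ, (∀ p, pairing p w = L p) ∧ ∀ k, MomRelaxPSD Es ge Is gi k w := by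
  have h1 : ∀ p, pairing p (fun α => L (monomial α 1)) = L p := by
    intro p
    conv_rhs => rw [p.as_sum, map_sum]
    refine Finset.sum_congr rfl fun α _ => ?_
    rw [← smul_eq_mul, ← map_smul, smul_monomial, smul_eq_mul, mul_one]
  refine ⟨_, h1, fun k => ⟨fun j hj p _ => ?_, fun j hj p _ => ?_, fun p _ => ?_⟩⟩
  · rw [h1]
    apply le_antisymm
    · have := hL (-(ge j * p)) (fun x hx => by simp [hx.1 j hj])
      rw [map_neg] at this; linarith
    · exact hL _ (fun x hx => by simp [hx.1 j hj])
  · rw [h1]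
    refine hL _ fun x hx => ?_
    rw [map_mul, map_pow]; exact mul_nonneg (hx.2 j hj) (sq_nonneg _)
  · rw [h1]
    refine hL _ fun x hx => ?_
    rw [map_pow]; exact sq_nonneg _

lemma strict_pert {X : Set (Fin N → ℝ)} (hX : IsCompact X) (fh : RPoly N) (ah : Fin m → RPoly N)
    (θ0 : Fin m → ℝ) (h : ∀ x ∈ X, 0 < eval x (fh - ∑ i, C (θ0 i) * ah i)) :
    ∃ δ : ℝ, 0 < δ ∧ ∀ x ∈ X, 0 < eval x (fh - ∑ i, C (θ0 i + δ) * ah i) := by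
  obtain ⟨ρ, hρ, hρ'⟩ := cpos hX (continuous_eval _) h
  obtain ⟨B, hB, hB'⟩ := cbd hX (continuous_eval (∑ i, ah i))
  refine ⟨ρ / (2 * B), by positivity, fun x hx => ?_⟩
  have k1 := hρ' x hx
  have k2 := (abs_le.mp (hB' x hx)).2
  simp only [map_sub, map_sum, map_mul, map_add, eval_C, add_mul, Finset.sum_add_distrib, ← Finset.mul_sum] at k1 k2 ⊢
  have k3 : ρ / (2 * B) * ∑ i, eval x (ah i) ≤ ρ / (2 * B) * B :=
    mul_le_mul_of_nonneg_left k2 (by positivity)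
  have k4 : ρ / (2 * B) * B = ρ / 2 := by field_simp
  linarith

end FT

/-- Theorem 4.3(ii): under the same assumptions, every minimizer of
the `k`th homogenized moment relaxation has a flat truncation for `k` large enough. -/
theorem statement_7
    (n m m1 d : ℕ) (hm1 : m1 ≤ m)
    (f : RPoly n) (a : Fin m → RPoly n) (b : Fin m → ℝ)
    (E I : Finset ℕ) (hEI : Disjoint E I) (c : ℕ → RPoly n)
    (hf : f.totalDegree ≤ d) (ha : ∀ i, (a i).totalDegree ≤ d)
    -- K is closed at infinity
    (hcl : ClosedAtInfinity E I c)
    -- H ∩ int(P_d(K)) ≠ ∅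
    (hH : ∃ θ : Fin m → ℝ, (∀ i : Fin m, m1 ≤ (i : ℕ) → 0 ≤ θ i) ∧
      (f - ∑ i, C (θ i) * a i) ∈ PdInterior d (Kset E I c))
    -- (M) has a minimizer y* ≠ 0
    (ys : (Fin n →₀ ℕ) → ℝ) (hyfeas : MFeas m1 d a b (Kset E I c) ys)
    (hymin : ∀ y : (Fin n →₀ ℕ) → ℝ, MFeas m1 d a b (Kset E I c) y →
      pairing f ys ≤ pairing f y)
    (hynz : ∃ α : Fin n →₀ ℕ, mdeg α ≤ d ∧ ys α ≠ 0)
    -- θ* is a maximizer of (P)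
    (θs : Fin m → ℝ) (hθfeas : PFeas m1 d f a (Kset E I c) θs)
    (hθmax : ∀ θ : Fin m → ℝ, PFeas m1 d f a (Kset E I c) θ →
      (∑ i, b i * θ i) ≤ ∑ i, b i * θs i)
    -- LICQC, SCC, SOSC at every global minimizer of (Q̃)
    (hopt : ∀ u : Fin (n + 1) → ℝ,
      (u ∈ Khom E I c ∧ ∀ x ∈ Khom E I c,
        eval u (homogAux d f - ∑ i, C (θs i) * homogAux d (a i))
          ≤ eval x (homogAux d f - ∑ i, C (θs i) * homogAux d (a i))) →
      OptCondsAt (OS E) (gEqH c) (OS I) (gInH c)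
        (homogAux d f - ∑ i, C (θs i) * homogAux d (a i)) u) :
    ∃ k1 : ℕ, ∀ k : ℕ, k1 ≤ k →
      ∀ w : (Fin (n + 1) →₀ ℕ) → ℝ,
        GMomFeas m1 (fun i => homogAux d (a i)) b (OS E) (gEqH c) (OS I) (gInH c) k w →
        (∀ w' : (Fin (n + 1) →₀ ℕ) → ℝ,
          GMomFeas m1 (fun i => homogAux d (a i)) b (OS E) (gEqH c) (OS I) (gInH c) k w' →
          pairing (homogAux d f) w ≤ pairing (homogAux d f) w') →
        HasFlatTruncation (d0GMP f a E I c) (dKHom E I c) k w := by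
  have hFeas : Khom E I c = FT.Feas (OS E) (gEqH c) (OS I) (gInH c) := FT.khom_feas
  have hnone : (none : Option ℕ) ∈ OS E := Finset.mem_insert_self _ _
  have hge : gEqH c none = ∑ i, (X i : RPoly (n + 1)) ^ 2 - 1 := rfl
  have hcomp := FT.Feas.isCompact (ge := gEqH c) (Is := OS I) (gi := gInH c) none hnone hge
  rw [← hFeas] at hcomp
  have hFX := (FT.FF_nonneg_iff hf ha hcl θs).mp hθfeas.2
  obtain ⟨θ0, hθ0, hint⟩ := hH
  obtain ⟨δ, hδ, h1⟩ := FT.strict_pert hcomp (homogAux d f) (fun i => homogAux d (a i)) θ0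
    (FT.FF_pos hf ha hcl θ0 hint)
  obtain ⟨L, hL, hLeq, hLge, hLf⟩ := FT.duality hcomp m1 (homogAux d f) (fun i => homogAux d (a i)) b θs
    (fun i => θ0 i + δ) hθfeas.1 hFX
    (fun θ hθ hx => hθmax θ ⟨hθ, (FT.FF_nonneg_iff hf ha hcl θ).mpr hx⟩)
    (fun i hi => add_pos_of_nonneg_of_pos (hθ0 i hi) hδ) h1
  rw [hFeas] at hL hFX
  obtain ⟨w0, hw0, hw0psd⟩ := FT.psd_of_lin L hL
  obtain ⟨k1, hk1⟩ := FT.finish none hnone hge hFX (fun u hu h0 => hopt u ⟨hFeas ▸ hu, fun x hx => by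
    have h0' : eval u (homogAux d f - ∑ i, C (θs i) * homogAux d (a i)) = 0 := h0
    rw [h0']; rw [hFeas] at hx; exact hFX x hx⟩) (d0GMP f a E I c) (dKHom E I c)
  refine ⟨k1, fun k hk w hw hmin => hk1 k hk w hw.2.2 ?_⟩
  have hle := hmin w0 ⟨fun i hi => by rw [hw0]; exact hLeq i hi,
    fun i hi => by rw [hw0]; exact hLge i hi, hw0psd k⟩
  rw [hw0] at hle
  have hsum : ∑ i, b i * θs i ≤ ∑ i, θs i * pairing (homogAux d (a i)) w := by
    refine Finset.sum_le_sum fun i _ => ?_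
    by_cases hi : m1 ≤ (i : ℕ)
    · rw [mul_comm]; exact mul_le_mul_of_nonneg_left (hw.2.1 i hi) (hθfeas.1 i hi)
    · rw [hw.1 i (not_le.mp hi), mul_comm]
  show FT.pl w (homogAux d f - ∑ i, C (θs i) * homogAux d (a i)) ≤ 0
  have hcalc : FT.pl w (homogAux d f - ∑ i, C (θs i) * homogAux d (a i)) =
      pairing (homogAux d f) w - ∑ i, θs i * pairing (homogAux d (a i)) w := by
    rw [map_sub, map_sum]
    congr 1
    exact Finset.sum_congr rfl fun i _ => FT.pl_C_mul w _ _
  rw [hcalc]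
  linarith
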